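/- arXiv:2512.23285 — 2 statements merged into one kernel-verified Lean document; each statement's English description precedes it below -/
import Mathlib

section
/- For the binary Burnside process started from the state e_n with a single 1 in the last coordinate, for all integers n ≥ 3 and s ≥ 3, the chi-square distance to stationarity after s steps satisfies 5·(1/4)^{2s} ≤ χ²_{e_n}(s) ≤ 270·(1/4)^{2s}. -/
open Finset

attribute [local instance] Classical.propDecidable

/-- Stationary distribution of the binary Burnside process. -/
noncomputable def piDist (n : ℕ) (U : Finset ℕ) : ℝ :=
  1 / ((n + 1) * (n.choose U.card))

/-- Binary Burnside transition matrix entry. -/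
noncomputable def Kmat (n : ℕ) (x y : Finset ℕ) : ℝ :=
  (((2 * (n - (x ∪ y).card)).choose (n - (x ∪ y).card) : ℝ) *
      ((2 * ((y \ x).card)).choose ((y \ x).card)) *
      ((2 * ((x \ y).card)).choose ((x \ y).card)) *
      ((2 * ((x ∩ y).card)).choose ((x ∩ y).card))) /
    (4 ^ n * (((n - (x ∪ y).card) + (y \ x).card).choose (n - (x ∪ y).card)) *
      (((x \ y).card + (x ∩ y).card).choose ((x \ y).card)))

/-- Action of K_n on functions. -/
noncomputable def Kop (n : ℕ) (f : Finset ℕ → ℝ) : Finset ℕ → ℝ :=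
  fun x => ∑ y ∈ (Finset.Icc 1 n).powerset, Kmat n x y * f y

/-- s-step transition probabilities. -/
noncomputable def Kpow (n : ℕ) : ℕ → Finset ℕ → Finset ℕ → ℝ
  | 0 => fun x y => if x = y then 1 else 0
  | s + 1 => fun x y => ∑ z ∈ (Finset.Icc 1 n).powerset, Kmat n x z * Kpow n s z y

/-- Chi-square distance to stationarity after s steps, started at x. -/
noncomputable def chiSq (n s : ℕ) (x : Finset ℕ) : ℝ :=
  ∑ y ∈ (Finset.Icc 1 n).powerset, (Kpow n s x y - piDist n y) ^ 2 / piDist n y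

/-- Eigenvalues. -/
noncomputable def betaEV (k : ℕ) : ℝ := (((2 * k).choose k : ℝ)) ^ 2 / 16 ^ k

/-- The eigenvectors f_S of Diaconis–Lin–Ram. -/
noncomputable def fSvec (S : Finset ℕ) : Finset ℕ → ℝ :=
  fun U => (-1 : ℝ) ^ ((S ∩ U).card) * (S.card.choose ((S ∩ U).card))

/-- Inner product with respect to π. -/
noncomputable def innerPi (n : ℕ) (f g : Finset ℕ → ℝ) : ℝ :=
  ∑ U ∈ (Finset.Icc 1 n).powerset, f U * g U * piDist n U

/-- The scalars T_{m,n}^{(ℓ)}(i). -/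
noncomputable def Tcoef (n m ℓ i : ℕ) : ℝ :=
  ∑ j ∈ Finset.range (i + 1),
    if j ≤ ℓ then
      (-1 : ℝ) ^ (m + j) * ((2 * m + ℓ).choose (m + j)) * (i.choose j) *
        ((n - 2 * m - i).choose (ℓ - j))
    else 0

/-- The vector g_T^{m,i} associated to the column reading tableau. -/
noncomputable def gT (n m i : ℕ) : Finset ℕ → ℝ := fun U =>
  if (∀ r ∈ Finset.Icc 1 m, ((2 * r - 1 ∈ U) ↔ ¬(2 * r ∈ U))) ∧
      (U ∩ Finset.Icc (2 * m + 1) n).card = i then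
    (-1 : ℝ) ^ ((U ∩ (Finset.range m).image (fun r => 2 * r + 1)).card)
  else 0

/-- The vector f_T^{m,ℓ} associated to the column reading tableau. -/
noncomputable def fT (n m ℓ : ℕ) : Finset ℕ → ℝ :=
  fun U => ∑ i ∈ Finset.range (n - 2 * m + 1), Tcoef n m ℓ i * gT n m i U

/-- Action of the adjacent transposition s_t (switching t and t+1) on functions. -/
noncomputable def sOp (t : ℕ) (f : Finset ℕ → ℝ) : Finset ℕ → ℝ :=
  fun U => f (U.image (Equiv.swap t (t + 1)))

/-- The factor s_t − 1/(t − 2r + 2) (r is the 1-indexed position in the second row). -/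
noncomputable def tauFactor (r t : ℕ) (f : Finset ℕ → ℝ) : Finset ℕ → ℝ :=
  fun U => sOp t f U - ((t : ℝ) - 2 * r + 2)⁻¹ * f U

/-- Composition (s_{2r+k-1} − ⋯)⋯(s_{2r} − 1/2) of k successive factors. -/
noncomputable def tauComp (r : ℕ) : ℕ → (Finset ℕ → ℝ) → (Finset ℕ → ℝ)
  | 0 => id
  | k + 1 => fun f => tauFactor r (2 * r + k) (tauComp r k f)

/-- τ_Q^{(r)} τ_Q^{(r+1)} ⋯ for the remaining second-row entries. -/
noncomputable def tauQAux : ℕ → List ℕ → (Finset ℕ → ℝ) → (Finset ℕ → ℝ)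
  | _, [] => id
  | r, a :: rest => fun f => tauComp r (a - 2 * r) (tauQAux (r + 1) rest f)

/-- The operator τ_Q for a tableau Q encoded by its list of second-row entries. -/
noncomputable def tauQ (Q : List ℕ) : (Finset ℕ → ℝ) → (Finset ℕ → ℝ) := tauQAux 1 Q

/-- A standard Young tableau of shape (n − Q.length, Q.length), encoded by the strictly
increasing list of second-row entries, each entry a_r satisfying 2r ≤ a_r ≤ n. -/
def IsSYT (n : ℕ) (Q : List ℕ) : Prop :=
  Q.Chain' (· < ·) ∧ (∀ x ∈ Q, x ≤ n) ∧ ∀ r < Q.length, 2 * (r + 1) ≤ Q.getD r 0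

/-- The eigenvectors f_Q^{m,ℓ} (here m = Q.length). -/
noncomputable def fQvec (n : ℕ) (Q : List ℕ) (ℓ : ℕ) : Finset ℕ → ℝ :=
  tauQ Q (fT n Q.length ℓ)

/-- The orthogonal vectors g_Q^{m,i} (here m = Q.length). -/
noncomputable def gQvec (n : ℕ) (Q : List ℕ) (i : ℕ) : Finset ℕ → ℝ :=
  tauQ Q (gT n Q.length i)

/-- The constant γ_Q. -/
noncomputable def gammaQ (Q : List ℕ) : ℝ :=
  ∏ r ∈ Finset.range Q.length, ∏ c ∈ Finset.Icc 2 (Q.getD r 0 - 2 * (r + 1) + 1),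
    ((c : ℝ) ^ 2 - 1) / (c : ℝ) ^ 2

/-- The Murphy (Jucys–Murphy) operator M_r acting on functions. -/
noncomputable def murphy (r : ℕ) (f : Finset ℕ → ℝ) : Finset ℕ → ℝ :=
  fun U => ∑ i ∈ Finset.Icc 1 (r - 1), f (U.image (Equiv.swap i r))

/-- The state space as a finite type. -/
noncomputable def transpEndo (n a b : ℕ) :
    Module.End ℝ ((↥((Finset.Icc 1 n).powerset)) → ℝ) where
  toFun f U := f (if h : U.1.image (Equiv.swap a b) ∈ (Finset.Icc 1 n).powerset
    then ⟨U.1.image (Equiv.swap a b), h⟩ else U)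
  map_add' f g := rfl
  map_smul' c f := rfl

noncomputable def murphyEndo (n r : ℕ) :
    Module.End ℝ ((↥((Finset.Icc 1 n).powerset)) → ℝ) :=
  ∑ i ∈ Finset.Icc 1 (r - 1), transpEndo n i r

noncomputable def KEndo (n : ℕ) :
    Module.End ℝ ((↥((Finset.Icc 1 n).powerset)) → ℝ) where
  toFun f x := ∑ y : ↥((Finset.Icc 1 n).powerset), Kmat n x.1 y.1 * f y
  map_add' f g := by funext x; simp [mul_add, Finset.sum_add_distrib]
  map_smul' c f := by funext x; simp [Finset.mul_sum, mul_left_comm]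

/-- The moments `∫ p ^ r` of the arcsine law on `[0, 1]`. -/
noncomputable def arcMoment (r : ℕ) : ℝ := (Nat.centralBinom r : ℝ) / 4 ^ r

/-- The mixed moments `∫ p ^ i * (1 - p) ^ (a - i)` of the arcsine law on `[0, 1]`. -/
noncomputable def arcWeight (a i : ℕ) : ℝ :=
  ((Nat.centralBinom i : ℝ) * Nat.centralBinom (a - i)) / (4 ^ a * a.choose i)

/-- The top finite difference of `r ↦ arcMoment r * arcMoment (d - r)`. -/
noncomputable def kernelEV (d : ℕ) : ℝ :=
  ∑ r ∈ range (d + 1), (-1 : ℝ) ^ (d - r) * d.choose r * (arcMoment r * arcMoment (d - r))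

lemma arcMoment_succ (r : ℕ) :
    (2 * (r : ℝ) + 2) * arcMoment (r + 1) = (2 * r + 1) * arcMoment r := by
  have h := Nat.succ_mul_centralBinom_succ r
  have h' : ((r : ℝ) + 1) * (Nat.centralBinom (r + 1) : ℝ)
      = 2 * (2 * r + 1) * Nat.centralBinom r := by exact_mod_cast h
  unfold arcMoment
  rw [pow_succ]
  field_simp
  linear_combination 2 * h'

lemma arcWeight_self (a : ℕ) : arcWeight a a = arcMoment a := by
  simp [arcWeight, arcMoment]

lemma arcWeight_eq (i j : ℕ) :
    arcWeight (i + j) i = arcMoment i * arcMoment j * (i.factorial * j.factorial)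
      / (i + j).factorial := by
  have h : ((i + j).choose i : ℝ) = (i + j).factorial / (i.factorial * j.factorial) := by
    rw [Nat.cast_add_choose]
  simp only [arcWeight, arcMoment, h, Nat.add_sub_cancel_left, pow_add]
  have := Nat.factorial_ne_zero
  field_simp

lemma arcWeight_add (a i : ℕ) (h : i ≤ a) :
    arcWeight (a + 1) i + arcWeight (a + 1) (i + 1) = arcWeight a i := by
  obtain ⟨j, rfl⟩ := Nat.exists_eq_add_of_le h
  have h1 := arcMoment_succ i
  have h2 := arcMoment_succ j
  have e1 : arcMoment (i + 1) = (2 * i + 1) * arcMoment i / (2 * i + 2) := by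
    field_simp; linear_combination h1
  have e2 : arcMoment (j + 1) = (2 * j + 1) * arcMoment j / (2 * j + 2) := by
    field_simp; linear_combination h2
  have r1 : i + j + 1 = i + (j + 1) := by ring
  have r2 : i + j + 1 = (i + 1) + j := by ring
  rw [show arcWeight (i + j + 1) i = arcWeight (i + (j + 1)) i by rw [r1],
    show arcWeight (i + j + 1) (i + 1) = arcWeight ((i + 1) + j) (i + 1) by rw [r2],
    arcWeight_eq, arcWeight_eq, arcWeight_eq, ← r1, ← r2, e1, e2]
  simp only [Nat.factorial_succ]
  push_cast
  have := Nat.factorial_ne_zero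
  field_simp
  ring

lemma sum_choose_mul_arcWeight (m r t : ℕ) (ht : t ≤ r) :
    ∑ i ∈ range (m + 1), (m.choose i : ℝ) * arcWeight (m + r) (i + t) = arcWeight r t := by
  induction m generalizing r t with
  | zero => simp
  | succ m ih =>
    rw [Finset.sum_range_succ']
    simp only [Nat.choose_succ_succ', Nat.cast_add, add_mul, Finset.sum_add_distrib]
    have e := ih (r + 1) (t + 1) (by omega)
    have e' := ih (r + 1) t (by omega)
    rw [Finset.sum_range_succ'] at e'
    rw [Finset.sum_range_succ (n := m)
      (f := fun i => ((m.choose (i + 1) : ℕ) : ℝ) * arcWeight (m + 1 + r) (i + 1 + t))]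
    have a1 : ∀ i, i + 1 + t = i + (t + 1) := fun i => by ring
    have a2 : m + 1 + r = m + (r + 1) := by ring
    simp only [a1, a2] at e e' ⊢
    rw [e, ← arcWeight_add r t ht, ← e']
    simp
    ring

lemma sum_choose_mul_arcWeight_mul_choose (a r : ℕ) :
    ∑ i ∈ range (a + 1), (a.choose i : ℝ) * arcWeight a i * i.choose r
      = a.choose r * arcMoment r := by
  rcases lt_or_ge a r with h | h
  · rw [Nat.choose_eq_zero_of_lt h, Nat.cast_zero, zero_mul]
    refine Finset.sum_eq_zero fun i hi => ?_
    rw [Nat.choose_eq_zero_of_lt (by simp at hi; omega : i < r)]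
    simp
  obtain ⟨m, rfl⟩ := Nat.exists_eq_add_of_le' h
  rw [show m + r + 1 = r + (m + 1) by ring, Finset.sum_range_add]
  rw [Finset.sum_eq_zero (s := range r)]
  · rw [zero_add, ← arcWeight_self, ← sum_choose_mul_arcWeight m r r le_rfl, Finset.mul_sum]
    refine Finset.sum_congr rfl fun i hi => ?_
    have hi' : i ≤ m := by simp at hi; omega
    have := Nat.choose_mul (n := m + r) (k := r + i) (s := r) (by omega)
    simp only [Nat.add_sub_cancel_left, Nat.add_sub_cancel] at this
    have h' : ((m + r).choose (r + i) : ℝ) * (r + i).choose r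
        = (m + r).choose r * m.choose i := by exact_mod_cast this
    rw [add_comm i r]
    linear_combination arcWeight (m + r) (r + i) * h'
  · intro i hi
    rw [Nat.choose_eq_zero_of_lt (by simpa using hi : i < r)]
    simp

/-- The moments of `cos θ` for uniform `θ`. -/
noncomputable def cosMoment (i : ℕ) : ℝ := if 2 ∣ i then arcMoment (i / 2) else 0

lemma centralBinom_eq_sum (r : ℕ) :
    Nat.centralBinom r = ∑ i ∈ range (r + 1),
      (if 2 ∣ i then i.choose (i / 2) else 0) * 2 ^ (r - i) * r.choose i := by
  open Polynomial in
  have h : ((X : ℕ[X]) + 1) ^ (2 * r)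
      = (expand ℕ 2 (X + 1) + 2 * X) ^ r := by
    rw [pow_mul]; congr 1; simp; ring
  have h2 := congrArg (fun p => Polynomial.coeff p r) h
  simp only [Polynomial.coeff_X_add_one_pow] at h2
  rw [Nat.centralBinom]
  simp only [Nat.cast_id] at h2
  rw [h2, add_pow, Polynomial.finsetSum_coeff]
  refine Finset.sum_congr rfl fun i hi => ?_
  have hi' : i ≤ r := by simp at hi; omega
  rw [mul_pow, ← map_pow]
  have e : (Polynomial.expand ℕ 2 ((Polynomial.X + 1) ^ i) *
      ((2 : Polynomial ℕ) ^ (r - i) * Polynomial.X ^ (r - i)) * ((r.choose i : ℕ) : Polynomial ℕ))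
      = Polynomial.C (2 ^ (r - i) * r.choose i) *
        (Polynomial.expand ℕ 2 ((Polynomial.X + 1) ^ i) * Polynomial.X ^ (r - i)) := by
    have hC : Polynomial.C (r.choose i) = ((r.choose i : ℕ) : Polynomial ℕ) := by simp
    simp only [map_mul, map_pow, map_ofNat, hC]; ring
  rw [e, Polynomial.coeff_C_mul, Polynomial.coeff_mul_X_pow', if_pos (by omega),
    Nat.sub_sub_self hi', Polynomial.coeff_expand (by norm_num)]
  simp only [Polynomial.coeff_X_add_one_pow, Nat.cast_id]
  ring

lemma arcMoment_eq_sum (r : ℕ) :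
    arcMoment r = (1 / 2) ^ r * ∑ i ∈ range (r + 1), (r.choose i : ℝ) * cosMoment i := by
  rw [arcMoment, centralBinom_eq_sum r]
  push_cast
  rw [Finset.mul_sum, Finset.sum_div]
  refine Finset.sum_congr rfl fun i hi => ?_
  have hi' : i ≤ r := by simp at hi; omega
  obtain ⟨j, rfl⟩ := Nat.exists_eq_add_of_le hi'
  unfold cosMoment
  split_ifs with h
  · obtain ⟨k, rfl⟩ := h
    rw [Nat.mul_div_cancel_left _ (by norm_num), arcMoment, Nat.centralBinom]
    have e4 : ∀ n : ℕ, (4 : ℝ) ^ n = 2 ^ n * 2 ^ n := fun n => by rw [← mul_pow]; norm_num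
    simp only [Nat.add_sub_cancel_left, e4, one_div, inv_pow]
    field_simp
    ring
  · simp

lemma mk_arcMoment_eq :
    (PowerSeries.mk fun r => arcMoment r / r.factorial) = PowerSeries.rescale (1 / 2 : ℝ)
      (PowerSeries.exp ℝ * PowerSeries.mk fun i => cosMoment i / i.factorial) := by
  ext r
  rw [PowerSeries.coeff_mk, PowerSeries.coeff_rescale, PowerSeries.coeff_mul,
    arcMoment_eq_sum, mul_div_assoc, Finset.sum_div, ← Nat.sum_antidiagonal_swap,
    Finset.Nat.sum_antidiagonal_eq_sum_range_succ_mk]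
  congr 1
  refine Finset.sum_congr rfl fun i hi => ?_
  have hi' : i ≤ r := by simp at hi; omega
  simp only [Prod.swap_prod_mk, PowerSeries.coeff_exp, PowerSeries.coeff_mk]
  rw [Nat.cast_choose ℝ hi']
  have := Nat.factorial_ne_zero
  simp only [map_div₀, map_one, map_natCast]
  field_simp

lemma evalNegHom_mk_cosMoment :
    PowerSeries.evalNegHom (PowerSeries.mk fun i => cosMoment i / i.factorial)
      = PowerSeries.mk fun i => cosMoment i / i.factorial := by
  ext i
  rw [PowerSeries.evalNegHom, PowerSeries.coeff_rescale, PowerSeries.coeff_mk]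
  by_cases h : 2 ∣ i
  · rw [(even_iff_two_dvd.mpr h).neg_one_pow, one_mul]
  · simp [cosMoment, h]

lemma kernelEV_eq_coeff (d : ℕ) :
    kernelEV d = d.factorial * ((1 / 2) ^ d *
      ∑ p ∈ antidiagonal d, cosMoment p.1 / p.1.factorial * (cosMoment p.2 / p.2.factorial)) := by
  set I : PowerSeries ℝ := PowerSeries.mk fun i => cosMoment i / i.factorial with hI
  set f : PowerSeries ℝ := PowerSeries.mk fun r => arcMoment r / r.factorial with hf
  have h1 : f * PowerSeries.evalNegHom f = PowerSeries.rescale (1 / 2 : ℝ) (I * I) := by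
    have h2 : PowerSeries.evalNegHom f = PowerSeries.rescale (1 / 2 : ℝ)
        (PowerSeries.evalNegHom (PowerSeries.exp ℝ) * I) := by
      rw [hI, ← evalNegHom_mk_cosMoment, ← map_mul, hf, mk_arcMoment_eq]
      simp only [PowerSeries.evalNegHom, PowerSeries.rescale_rescale]
      rw [mul_comm]
    rw [h2, hf, mk_arcMoment_eq, ← map_mul]
    congr 1
    linear_combination I * I * PowerSeries.exp_mul_exp_neg_eq_one (A := ℝ)
  have h3 := congrArg (PowerSeries.coeff d) h1
  rw [PowerSeries.coeff_rescale, PowerSeries.coeff_mul, PowerSeries.coeff_mul] at h3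
  simp only [hI, PowerSeries.coeff_mk] at h3
  rw [← h3, Finset.Nat.sum_antidiagonal_eq_sum_range_succ_mk, kernelEV, Finset.mul_sum]
  refine Finset.sum_congr rfl fun i hi => ?_
  have hi' : i ≤ d := by simp at hi; omega
  simp only [PowerSeries.evalNegHom, PowerSeries.coeff_rescale, hf, PowerSeries.coeff_mk]
  rw [Nat.cast_choose ℝ hi']
  have := Nat.factorial_ne_zero
  field_simp

lemma kernelEV_of_odd {d : ℕ} (hd : ¬ 2 ∣ d) : kernelEV d = 0 := by
  rw [kernelEV_eq_coeff, Finset.sum_eq_zero, mul_zero, mul_zero]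
  intro p hp
  have hp' := HasAntidiagonal.mem_antidiagonal.mp hp
  unfold cosMoment
  by_cases h : 2 ∣ p.1
  · have : ¬ 2 ∣ p.2 := by omega
    simp [this]
  · simp [h]

lemma cosMoment_two_mul_div_factorial (k : ℕ) :
    cosMoment (2 * k) / (2 * k).factorial = (1 / 4) ^ k / (k.factorial : ℝ) ^ 2 := by
  have h : (Nat.centralBinom k : ℝ) = (2 * k).factorial / ((k.factorial : ℝ) * k.factorial) := by
    rw [Nat.centralBinom, two_mul, Nat.cast_add_choose]
  rw [cosMoment, if_pos ⟨k, rfl⟩, Nat.mul_div_cancel_left _ (by norm_num), arcMoment, h]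
  have := Nat.factorial_ne_zero
  simp only [one_div, inv_pow]
  field_simp

lemma kernelEV_two_mul (k : ℕ) : kernelEV (2 * k) = arcMoment k ^ 2 := by
  have hs : ∑ p ∈ antidiagonal (2 * k),
      cosMoment p.1 / p.1.factorial * (cosMoment p.2 / p.2.factorial)
      = ∑ p ∈ antidiagonal k, (1 / 4) ^ k * (1 / (k.factorial : ℝ) ^ 2) *
        ((k.choose p.1 : ℕ) ^ 2 : ℕ) := by
    symm
    refine Finset.sum_of_injOn (fun p => (2 * p.1, 2 * p.2)) ?_ ?_ ?_ ?_
    · rintro ⟨a, b⟩ _ ⟨c, d⟩ _ h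
      simpa using h
    · rintro ⟨a, b⟩ h
      simp at h ⊢
      omega
    · rintro ⟨a, b⟩ h h'
      have hn : ¬ 2 ∣ a := by
        rintro ⟨c, rfl⟩
        apply h'
        rw [HasAntidiagonal.mem_antidiagonal] at h
        refine ⟨(c, k - c), ?_, ?_⟩
        · simp at h ⊢; omega
        · simp at h ⊢; omega
      simp [cosMoment, hn]
    · rintro ⟨a, b⟩ h
      rw [HasAntidiagonal.mem_antidiagonal] at h
      simp only at h
      subst h
      simp only [cosMoment_two_mul_div_factorial, Nat.cast_pow, Nat.cast_add_choose, pow_add]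
      have := Nat.factorial_ne_zero
      field_simp
  rw [kernelEV_eq_coeff, hs, ← Finset.mul_sum, ← Nat.cast_sum,
    Finset.Nat.sum_antidiagonal_eq_sum_range_succ_mk]
  simp only
  rw [Nat.sum_range_choose_sq, arcMoment, Nat.centralBinom]
  have h : ((2 * k).choose k : ℝ) = (2 * k).factorial / ((k.factorial : ℝ) * k.factorial) := by
    rw [two_mul, Nat.cast_add_choose]
  rw [h]
  have := Nat.factorial_ne_zero
  rw [pow_mul]
  simp only [one_div, inv_pow]
  rw [show (4 : ℝ) = 2 ^ 2 by norm_num]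
  field_simp

lemma kernelEV_zero : kernelEV 0 = 1 := by simpa [arcMoment] using kernelEV_two_mul 0

lemma kernelEV_two : kernelEV 2 = 1 / 4 := by
  have h := kernelEV_two_mul 1
  rw [mul_one] at h
  rw [h]
  norm_num [arcMoment, Nat.centralBinom, Nat.choose]

lemma kernelEV_nonneg (d : ℕ) : 0 ≤ kernelEV d := by
  by_cases h : 2 ∣ d
  · obtain ⟨k, rfl⟩ := h
    rw [kernelEV_two_mul]; positivity
  · rw [kernelEV_of_odd h]

lemma arcMoment_sq_le (k : ℕ) (hk : 1 ≤ k) : (3 * (k : ℝ) + 1) * arcMoment k ^ 2 ≤ 1 := by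
  induction k, hk using Nat.le_induction with
  | base => norm_num [arcMoment, Nat.centralBinom, Nat.choose]
  | succ k hk ih =>
    have e : arcMoment (k + 1) = (2 * k + 1) * arcMoment k / (2 * k + 2) := by
      have := arcMoment_succ k
      field_simp; linear_combination this
    have hk0 : (0 : ℝ) ≤ k := Nat.cast_nonneg k
    calc (3 * ((k + 1 : ℕ) : ℝ) + 1) * arcMoment (k + 1) ^ 2
        = ((3 * k + 4) * (2 * k + 1) ^ 2 / ((2 * k + 2) ^ 2 * (3 * k + 1))) *
          ((3 * (k : ℝ) + 1) * arcMoment k ^ 2) := by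
          rw [e]; push_cast; field_simp; ring
      _ ≤ 1 * 1 := by
          gcongr
          rw [div_le_one (by positivity)]
          nlinarith
      _ = 1 := by norm_num

/-- Each degree contributes at most `360 * 16⁻ˢ / (d (d + 1))³`, after three steps. -/
lemma kernelEV_pow_le (d s : ℕ) (hs : 3 ≤ s) :
    ((d : ℝ) * (d + 1)) ^ 3 * kernelEV d ^ (2 * s) ≤ 360 * (1 / 4) ^ (2 * s) := by
  by_cases h : 2 ∣ d
  swap
  · rw [kernelEV_of_odd h, zero_pow (by omega), mul_zero]
    positivity
  obtain ⟨k, rfl⟩ := h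
  rcases Nat.eq_zero_or_pos k with rfl | hk
  · simp
  have h1 := arcMoment_sq_le k hk
  rw [kernelEV_two_mul]
  have hk' : (1 : ℝ) ≤ k := by exact_mod_cast hk
  set b := arcMoment k ^ 2 with hb
  have hb0 : 0 ≤ b := by positivity
  have hb1 : 4 * b ≤ 1 := by nlinarith
  have hb2 : (2 * k : ℝ) * (2 * k + 1) * (4 * b) ^ 2 ≤ 64 / 9 := by
    have h2 : ((3 * (k : ℝ) + 1) * b) ^ 2 ≤ 1 := by
      apply pow_le_one₀ (by positivity) h1
    nlinarith [mul_nonneg hb0 hb0]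
  obtain ⟨t, rfl⟩ := Nat.exists_eq_add_of_le hs
  have e : (1 / 4 : ℝ) ^ (2 * (3 + t)) * ((4 * b) ^ (2 * t) * (4 * b) ^ 6) = b ^ (2 * (3 + t)) := by
    rw [← pow_add, show 2 * t + 6 = 2 * (3 + t) by ring, ← mul_pow]
    congr 1; ring
  rw [← e]
  have h3 : ((2 * k : ℝ) * (2 * k + 1) * (4 * b) ^ 2) ^ 3 ≤ 360 :=
    (pow_le_pow_left₀ (by positivity) hb2 3).trans (by norm_num)
  have h4 : (4 * b) ^ (2 * t) ≤ 1 := pow_le_one₀ (by positivity) hb1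
  push_cast
  calc _ = ((2 * k : ℝ) * (2 * k + 1) * (4 * b) ^ 2) ^ 3 * (4 * b) ^ (2 * t) *
        (1 / 4 : ℝ) ^ (2 * (3 + t)) := by ring
    _ ≤ 360 * 1 * (1 / 4 : ℝ) ^ (2 * (3 + t)) := by gcongr
    _ = _ := by ring

/-- The Burnside chain lumped to the number of ones, acting on functions on `{0, …, N}`. -/
noncomputable def lumpedOp (N : ℕ) (v : ℕ → ℝ) : ℕ → ℝ := fun a =>
  ∑ i ∈ range (a + 1), ∑ j ∈ range (N - a + 1),
    (a.choose i * arcWeight a i) * ((N - a).choose j * arcWeight (N - a) j) * v (i + j)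

lemma sum_powerset_eq_sum_sum_union {I x : Finset ℕ} (hx : x ⊆ I) (F : Finset ℕ → ℝ) :
    ∑ y ∈ I.powerset, F y = ∑ A ∈ x.powerset, ∑ B ∈ (I \ x).powerset, F (A ∪ B) := by
  rw [← Finset.sum_product']
  refine Finset.sum_nbij' (fun y => (y ∩ x, y \ x)) (fun p => p.1 ∪ p.2) ?_ ?_ ?_ ?_ ?_
  · intro y hy
    rw [mem_powerset] at hy
    simp only [mem_product, mem_powerset]
    exact ⟨inter_subset_right, sdiff_subset_sdiff hy (le_refl _)⟩
  · rintro ⟨A, B⟩ h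
    simp only [mem_product, mem_powerset] at h ⊢
    exact union_subset (h.1.trans hx) (h.2.trans sdiff_subset)
  · intro y _
    ext i; simp; tauto
  · rintro ⟨A, B⟩ h
    simp only [mem_product, mem_powerset] at h
    have h1 : ∀ i ∈ A, i ∈ x := fun i hi => h.1 hi
    have h2 : ∀ i ∈ B, i ∉ x := fun i hi => (mem_sdiff.mp (h.2 hi)).2
    simp only [Prod.mk.injEq]
    constructor
    · ext i; have := h1 i; have := h2 i; simp; tauto
    · ext i; have := h1 i; have := h2 i; simp; tauto
  · intro y _
    congr 1
    ext i; simp; tauto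

lemma Kmat_union {n : ℕ} {x A B : Finset ℕ} (hx : x ⊆ Icc 1 n) (hA : A ⊆ x)
    (hB : B ⊆ Icc 1 n \ x) :
    Kmat n x (A ∪ B) = arcWeight #x #A * arcWeight (n - #x) #B := by
  have h1 : ∀ i ∈ A, i ∈ x := fun i hi => hA hi
  have h2 : ∀ i ∈ B, i ∉ x := fun i hi => (mem_sdiff.mp (hB hi)).2
  have hd : Disjoint x B := by
    rw [Finset.disjoint_left]; intro i hi hi'; exact h2 i hi' hi
  have e1 : x ∪ (A ∪ B) = x ∪ B := by ext i; have := h1 i; simp; tauto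
  have e2 : (A ∪ B) \ x = B := by ext i; have := h1 i; have := h2 i; simp; tauto
  have e3 : x \ (A ∪ B) = x \ A := by ext i; have := h2 i; simp; tauto
  have e4 : x ∩ (A ∪ B) = A := by ext i; have := h1 i; have := h2 i; simp; tauto
  have c1 : #(x ∪ B) = #x + #B := card_union_of_disjoint hd
  have c2 : #(x \ A) = #x - #A := card_sdiff_of_subset hA
  have l1 : #A ≤ #x := card_le_card hA
  have l2 : #x ≤ n := by simpa using card_le_card hx
  have l3 : #B ≤ n - #x := by
    have := card_le_card hB
    rwa [card_sdiff_of_subset hx, Nat.card_Icc, Nat.add_sub_cancel] at this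
  have s1 : (n - (#x + #B) + #B).choose (n - (#x + #B)) = (n - #x).choose #B := by
    rw [← Nat.choose_symm l3]; congr 1 <;> omega
  have s2 : (#x - #A + #A).choose (#x - #A) = (#x).choose #A := by
    rw [Nat.sub_add_cancel l1, Nat.choose_symm l1]
  have s3 : n - (#x + #B) = n - #x - #B := by omega
  have p : (4 : ℝ) ^ n = 4 ^ #x * 4 ^ (n - #x) := by rw [← pow_add]; congr 1; omega
  simp only [Kmat, arcWeight, e1, e2, e3, e4, c1, c2, s1, s2, Nat.centralBinom, p]
  rw [s3, div_mul_div_comm]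
  congr 1 <;> ring

lemma Kop_eq_sum_union {n : ℕ} {x : Finset ℕ} (hx : x ⊆ Icc 1 n) (F : Finset ℕ → ℝ) :
    Kop n F x = ∑ A ∈ x.powerset, ∑ B ∈ (Icc 1 n \ x).powerset,
      arcWeight #x #A * arcWeight (n - #x) #B * F (A ∪ B) := by
  rw [Kop, sum_powerset_eq_sum_sum_union hx]
  refine Finset.sum_congr rfl fun A hA => Finset.sum_congr rfl fun B hB => ?_
  rw [Kmat_union hx (mem_powerset.mp hA) (mem_powerset.mp hB)]

lemma sum_union_comp_card {X Y : Finset ℕ} (hXY : Disjoint X Y) (a b : ℕ) (ha : #X = a)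
    (hb : #Y = b) (v : ℕ → ℝ) :
    ∑ A ∈ X.powerset, ∑ B ∈ Y.powerset, arcWeight a #A * arcWeight b #B * v #(A ∪ B)
      = ∑ i ∈ range (a + 1), ∑ j ∈ range (b + 1),
        (a.choose i * arcWeight a i) * (b.choose j * arcWeight b j) * v (i + j) := by
  subst ha hb
  have h : ∀ A ∈ X.powerset, ∑ B ∈ Y.powerset, arcWeight #X #A * arcWeight #Y #B * v #(A ∪ B)
      = ∑ j ∈ range (#Y + 1), (#Y).choose j • (arcWeight #X #A * arcWeight #Y j * v (#A + j)) := by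
    intro A hA
    rw [← sum_powerset_apply_card (fun j => arcWeight #X #A * arcWeight #Y j * v (#A + j))]
    refine Finset.sum_congr rfl fun B hB => ?_
    rw [card_union_of_disjoint
      (hXY.mono (mem_powerset.mp hA) (mem_powerset.mp hB))]
  rw [Finset.sum_congr rfl h, sum_powerset_apply_card (fun i => ∑ j ∈ range (#Y + 1),
    (#Y).choose j • (arcWeight #X i * arcWeight #Y j * v (i + j)))]
  refine Finset.sum_congr rfl fun i _ => ?_
  rw [Finset.smul_sum]
  refine Finset.sum_congr rfl fun j _ => ?_
  simp only [nsmul_eq_mul]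
  ring

lemma card_Icc_sdiff {n : ℕ} {x : Finset ℕ} (hx : x ⊆ Icc 1 n) : #(Icc 1 n \ x) = n - #x := by
  rw [card_sdiff_of_subset hx, Nat.card_Icc, Nat.add_sub_cancel]

lemma Kop_comp_card {n : ℕ} {x : Finset ℕ} (hx : x ⊆ Icc 1 n) (v : ℕ → ℝ) :
    Kop n (fun y => v #y) x = lumpedOp n v #x := by
  rw [Kop_eq_sum_union hx, sum_union_comp_card disjoint_sdiff _ _ rfl (card_Icc_sdiff hx)]
  rfl

lemma sum_powerset_insert_arcWeight {X : Finset ℕ} {i : ℕ} (hi : i ∉ X) (G : Finset ℕ → ℝ) :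
    ∑ B ∈ (insert i X).powerset, arcWeight (#X + 1) #B * G (B.erase i)
      = ∑ B ∈ X.powerset, arcWeight #X #B * G B := by
  rw [Finset.sum_powerset_insert hi, ← Finset.sum_add_distrib]
  refine Finset.sum_congr rfl fun B hB => ?_
  have hB' := mem_powerset.mp hB
  have hiB : i ∉ B := fun h => hi (hB' h)
  rw [card_insert_of_notMem hiB, erase_insert hiB, erase_eq_of_notMem hiB,
    ← arcWeight_add _ _ (card_le_card hB')]
  ring

/-- Erasing a coordinate maps the Burnside chain on `n` coordinates to the one on `n - 1`. -/
lemma Kop_comp_card_erase {n i : ℕ} {x : Finset ℕ} (hx : x ⊆ Icc 1 n) (hi : i ∈ Icc 1 n)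
    (v : ℕ → ℝ) :
    Kop n (fun y => v #(y.erase i)) x = lumpedOp (n - 1) v #(x.erase i) := by
  rw [Kop_eq_sum_union hx]
  by_cases hix : i ∈ x
  · have hX : insert i (x.erase i) = x := insert_erase hix
    have hc : #x = #(x.erase i) + 1 := by rw [← card_erase_add_one hix]
    have hn : n - #x = n - 1 - #(x.erase i) := by omega
    have h : ∀ A ∈ x.powerset, ∑ B ∈ (Icc 1 n \ x).powerset,
        arcWeight #x #A * arcWeight (n - #x) #B * v #((A ∪ B).erase i)
        = arcWeight (#(x.erase i) + 1) #A * ∑ B ∈ (Icc 1 n \ x).powerset,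
          arcWeight (n - 1 - #(x.erase i)) #B * v #(A.erase i ∪ B) := by
      intro A _
      rw [Finset.mul_sum]
      refine Finset.sum_congr rfl fun B hB => ?_
      have hiB : i ∉ B := fun h => (mem_sdiff.mp (mem_powerset.mp hB h)).2 hix
      rw [erase_union_distrib, erase_eq_of_notMem hiB, ← hc, hn]
      ring
    have hs := sum_powerset_insert_arcWeight (notMem_erase i x)
      (fun A => ∑ B ∈ (Icc 1 n \ x).powerset,
        arcWeight (n - 1 - #(x.erase i)) #B * v #(A ∪ B))
    rw [hX] at hs
    rw [Finset.sum_congr rfl h, hs, lumpedOp, ← sum_union_comp_card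
      (disjoint_of_subset_left (erase_subset i x) disjoint_sdiff) _ _ rfl
      ((card_Icc_sdiff hx).trans hn)]
    simp only [Finset.mul_sum, mul_assoc]
  · have hi' : i ∈ Icc 1 n \ x := mem_sdiff.mpr ⟨hi, hix⟩
    set Y := (Icc 1 n \ x).erase i with hY
    have hX : insert i Y = Icc 1 n \ x := insert_erase hi'
    have hc' : #Y + 1 = n - #x := by rw [hY, card_erase_add_one hi', card_Icc_sdiff hx]
    have hc : #Y = n - 1 - #(x.erase i) := by rw [erase_eq_of_notMem hix]; omega
    have h : ∀ A ∈ x.powerset, ∑ B ∈ (Icc 1 n \ x).powerset,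
        arcWeight #x #A * arcWeight (n - #x) #B * v #((A ∪ B).erase i)
        = ∑ B ∈ Y.powerset, arcWeight #x #A * arcWeight #Y #B * v #(A ∪ B) := by
      intro A hA
      have hiA : i ∉ A := fun h => hix (mem_powerset.mp hA h)
      have hs := sum_powerset_insert_arcWeight (notMem_erase i (Icc 1 n \ x))
        (fun B => v #(A ∪ B))
      rw [← hY, hX] at hs
      simp only [mul_assoc]
      rw [← Finset.mul_sum, ← Finset.mul_sum, ← hs, hc']
      congr 1
      refine Finset.sum_congr rfl fun B _ => ?_
      rw [erase_union_distrib, erase_eq_of_notMem hiA]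
    rw [Finset.sum_congr rfl h, sum_union_comp_card
      (disjoint_of_subset_right (erase_subset _ _) disjoint_sdiff) _ _ rfl rfl, hc,
      erase_eq_of_notMem hix]
    rfl

lemma choose_mul_choose_mul_choose_mul_factorial (a b c d : ℕ) :
    (a + b + (c + d)).choose (c + d) * (a + b).choose a * (c + d).choose c *
      (a.factorial * b.factorial * c.factorial * d.factorial)
      = (a + b + (c + d)).factorial := by
  rw [← Nat.add_choose_mul_factorial_mul_factorial (a + b) (c + d),
    ← Nat.add_choose_mul_factorial_mul_factorial a b,
    ← Nat.add_choose_mul_factorial_mul_factorial c d, Nat.choose_symm_add (a := a),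
    Nat.choose_symm_add (a := c)]
  ring

lemma piDist_mul_Kmat {n : ℕ} {x y : Finset ℕ} (hx : x ⊆ Icc 1 n) (hy : y ⊆ Icc 1 n) :
    piDist n x * Kmat n x y = piDist n y * Kmat n y x := by
  have e1 : n - #(x ∪ y) + #(y \ x) + (#(x \ y) + #(x ∩ y)) = n := by
    have h1 : #(x ∪ y) ≤ n := by simpa using card_le_card (union_subset hx hy)
    have h2 := card_sdiff_add_card_inter x y
    have h3 := card_sdiff_add_card y x
    rw [union_comm] at h3
    omega
  have e2 : #x = #(x \ y) + #(x ∩ y) := (card_sdiff_add_card_inter x y).symm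
  have e3 : #y = #(y \ x) + #(x ∩ y) := by
    rw [inter_comm]; exact (card_sdiff_add_card_inter y x).symm
  unfold piDist Kmat
  rw [union_comm y x, inter_comm y x, e2, e3]
  generalize n - #(x ∪ y) = a at *
  generalize #(y \ x) = b at *
  generalize #(x \ y) = c at *
  generalize #(x ∩ y) = d at *
  have f1 := choose_mul_choose_mul_choose_mul_factorial a b c d
  have f2 := choose_mul_choose_mul_choose_mul_factorial a c b d
  rw [e1] at f1
  rw [show a + c + (b + d) = n by omega, ← f1] at f2
  have hfac : 0 < a.factorial * b.factorial * c.factorial * d.factorial := by positivity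
  rw [show a.factorial * c.factorial * b.factorial * d.factorial
    = a.factorial * b.factorial * c.factorial * d.factorial by ring] at f2
  have f3 := Nat.eq_of_mul_eq_mul_right hfac f2
  have f4 : ((n.choose (b + d) : ℕ) : ℝ) * (a + c).choose a * (b + d).choose b
    = n.choose (c + d) * (a + b).choose a * (c + d).choose c := by exact_mod_cast f3
  rw [div_mul_div_comm, div_mul_div_comm]
  congr 1
  · ring
  · linear_combination (-((n : ℝ) + 1) * 4 ^ n) * f4

lemma Kpow_succ' {n s : ℕ} {x y : Finset ℕ} (hx : x ⊆ Icc 1 n) (hy : y ⊆ Icc 1 n) :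
    Kpow n (s + 1) x y = ∑ z ∈ (Icc 1 n).powerset, Kpow n s x z * Kmat n z y := by
  induction s generalizing x with
  | zero => simp [Kpow, hx, hy]
  | succ s ih =>
    rw [Kpow]
    simp only
    rw [Finset.sum_congr rfl fun z hz => by rw [ih (mem_powerset.mp hz)]]
    simp only [Kpow, Finset.mul_sum, Finset.sum_mul, mul_assoc]
    exact Finset.sum_comm

lemma piDist_mul_Kpow {n s : ℕ} {x y : Finset ℕ} (hx : x ⊆ Icc 1 n) (hy : y ⊆ Icc 1 n) :
    piDist n x * Kpow n s x y = piDist n y * Kpow n s y x := by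
  induction s generalizing x y with
  | zero =>
    by_cases h : x = y
    · simp [h]
    · simp [Kpow, h, Ne.symm h]
  | succ s ih =>
    rw [Kpow_succ' hy hx, Kpow]
    simp only [Finset.mul_sum]
    refine Finset.sum_congr rfl fun z hz => ?_
    have hz' := mem_powerset.mp hz
    rw [← mul_assoc, piDist_mul_Kmat hx hz', mul_right_comm, ih hz' hy]
    ring

lemma piDist_pos {n : ℕ} {x : Finset ℕ} (hx : x ⊆ Icc 1 n) : 0 < piDist n x := by
  have : 0 < n.choose #x := Nat.choose_pos (by simpa using card_le_card hx)
  unfold piDist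
  positivity

lemma chiSq_eq_sum {n s : ℕ} {x : Finset ℕ} (hx : x ⊆ Icc 1 n) :
    chiSq n s x = ∑ y ∈ (Icc 1 n).powerset,
      piDist n y * (Kpow n s y x / piDist n x - 1) ^ 2 := by
  refine Finset.sum_congr rfl fun y hy => ?_
  have hy' := mem_powerset.mp hy
  have h1 := piDist_pos hx
  have h2 := piDist_pos hy'
  have h := piDist_mul_Kpow (s := s) hx hy'
  have h3 : Kpow n s y x / piDist n x = Kpow n s x y / piDist n y := by
    rw [div_eq_div_iff h1.ne' h2.ne']; linarith
  rw [h3]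
  field_simp

lemma sum_powerset_piDist (n : ℕ) (F : ℕ → ℝ) :
    ∑ y ∈ (Icc 1 n).powerset, piDist n y * F #y
      = (∑ a ∈ range (n + 1), F a) / ((n : ℝ) + 1) := by
  have := sum_powerset_apply_card (fun a => 1 / (((n : ℝ) + 1) * n.choose a) * F a) (x := Icc 1 n)
  simp only [piDist]
  rw [this, Nat.card_Icc, Nat.add_sub_cancel, Finset.sum_div]
  refine Finset.sum_congr rfl fun a ha => ?_
  have h : 0 < n.choose a := Nat.choose_pos (by simpa [Nat.lt_succ_iff] using ha)
  have h' : (0 : ℝ) < n.choose a := by exact_mod_cast h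
  rw [nsmul_eq_mul]
  field_simp

/-- The lumped chain is reversible with respect to the uniform distribution. -/
lemma sum_lumpedOp_mul (n : ℕ) (f g : ℕ → ℝ) :
    ∑ a ∈ range (n + 1), lumpedOp n f a * g a = ∑ a ∈ range (n + 1), f a * lumpedOp n g a := by
  have h1 := sum_powerset_piDist n (fun a => lumpedOp n f a * g a)
  have h2 := sum_powerset_piDist n (fun a => f a * lumpedOp n g a)
  have h3 : ∑ y ∈ (Icc 1 n).powerset, piDist n y * (lumpedOp n f #y * g #y)
      = ∑ y ∈ (Icc 1 n).powerset, piDist n y * (f #y * lumpedOp n g #y) := by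
    calc _ = ∑ y ∈ (Icc 1 n).powerset, ∑ z ∈ (Icc 1 n).powerset,
          piDist n y * Kmat n y z * (f #z * g #y) := by
          refine Finset.sum_congr rfl fun y hy => ?_
          rw [← Kop_comp_card (mem_powerset.mp hy), Kop, Finset.sum_mul, Finset.mul_sum]
          refine Finset.sum_congr rfl fun z _ => ?_
          ring
      _ = ∑ z ∈ (Icc 1 n).powerset, ∑ y ∈ (Icc 1 n).powerset,
          piDist n y * Kmat n y z * (f #z * g #y) := Finset.sum_comm
      _ = _ := by
          refine Finset.sum_congr rfl fun y hy => ?_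
          rw [← Kop_comp_card (mem_powerset.mp hy), Kop, Finset.mul_sum, Finset.mul_sum]
          refine Finset.sum_congr rfl fun z hz => ?_
          rw [piDist_mul_Kmat (mem_powerset.mp hz) (mem_powerset.mp hy)]
          ring
  rw [h1, h2] at h3
  have : (n : ℝ) + 1 ≠ 0 := by positivity
  field_simp at h3
  exact h3

lemma lumpedOp_add (N : ℕ) (f g : ℕ → ℝ) : lumpedOp N (f + g) = lumpedOp N f + lumpedOp N g := by
  funext a
  simp only [lumpedOp, Pi.add_apply, mul_add, Finset.sum_add_distrib]

lemma lumpedOp_smul (N : ℕ) (c : ℝ) (f : ℕ → ℝ) : lumpedOp N (c • f) = c • lumpedOp N f := by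
  funext a
  simp only [lumpedOp, Pi.smul_apply, smul_eq_mul, Finset.mul_sum]
  refine Finset.sum_congr rfl fun i _ => Finset.sum_congr rfl fun j _ => ?_
  ring

lemma lumpedOp_congr {N : ℕ} {f g : ℕ → ℝ} (h : ∀ j ≤ N, f j = g j) {a : ℕ} (ha : a ≤ N) :
    lumpedOp N f a = lumpedOp N g a := by
  refine Finset.sum_congr rfl fun i hi => Finset.sum_congr rfl fun j hj => ?_
  rw [mem_range] at hi hj
  rw [h (i + j) (by omega)]

/-- The `s`-th iterate of `lumpedOp` applied to `f`. -/
noncomputable def lumpedPow (N s : ℕ) (f : ℕ → ℝ) : ℕ → ℝ := (lumpedOp N)^[s] f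

lemma lumpedPow_succ (N s : ℕ) (f : ℕ → ℝ) :
    lumpedPow N (s + 1) f = lumpedOp N (lumpedPow N s f) := Function.iterate_succ_apply' _ _ _

lemma Kpow_singleton {n : ℕ} (hn : 1 ≤ n) (s : ℕ) {x : Finset ℕ} (hx : x ⊆ Icc 1 n) :
    Kpow n s x {n} = lumpedPow (n - 1) s (Pi.single 0 1) #(x.erase n)
      - lumpedPow n s (Pi.single 0 1) #x := by
  induction s generalizing x with
  | zero =>
    have h : x.erase n = ∅ ↔ x = ∅ ∨ x = {n} := erase_eq_empty_iff x n
    simp only [Kpow, lumpedPow, Function.iterate_zero, id, Pi.single_apply, card_eq_zero, h]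
    by_cases h1 : x = ∅ <;> by_cases h2 : x = {n} <;> simp [h1, h2]
  | succ s ih =>
    rw [lumpedPow_succ, lumpedPow_succ, ← Kop_comp_card hx,
      ← Kop_comp_card_erase hx (mem_Icc.mpr ⟨hn, le_refl n⟩), Kpow, Kop, Kop,
      ← Finset.sum_sub_distrib]
    refine Finset.sum_congr rfl fun z hz => ?_
    rw [ih (mem_powerset.mp hz), mul_sub]

/-- The sum of `f` over the sizes of the sets obtained from a set of size `j` in `{1, …, n}` by
erasing one of the `n` coordinates. -/
noncomputable def eraseSum (n : ℕ) (f : ℕ → ℝ) : ℕ → ℝ := fun j =>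
  ((n : ℝ) - j) * f j + j * f (j - 1)

lemma eraseSum_card {n : ℕ} {x : Finset ℕ} (hx : x ⊆ Icc 1 n) (f : ℕ → ℝ) :
    eraseSum n f #x = ∑ i ∈ Icc 1 n, f #(x.erase i) := by
  rw [← Finset.sum_sdiff hx, Finset.sum_congr rfl fun i hi => by
      rw [erase_eq_of_notMem (mem_sdiff.mp hi).2],
    Finset.sum_congr (s₁ := x) rfl fun i hi => by rw [card_erase_of_mem hi],
    Finset.sum_const, Finset.sum_const, card_Icc_sdiff hx, nsmul_eq_mul, nsmul_eq_mul,
    Nat.cast_sub (by simpa using card_le_card hx), eraseSum]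

lemma lumpedOp_eraseSum {n j : ℕ} (hj : j ≤ n) (f : ℕ → ℝ) :
    lumpedOp n (eraseSum n f) j = eraseSum n (lumpedOp (n - 1) f) j := by
  obtain ⟨x, hx, rfl⟩ : ∃ x ⊆ Icc 1 n, #x = j := ⟨Icc 1 j, Icc_subset_Icc_right hj, by simp⟩
  rw [eraseSum_card hx, ← Kop_comp_card hx, Finset.sum_congr rfl fun i hi => (Kop_comp_card_erase hx hi f).symm]
  simp only [Kop]
  rw [Finset.sum_comm]
  refine Finset.sum_congr rfl fun y hy => ?_
  rw [eraseSum_card (mem_powerset.mp hy), Finset.mul_sum]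

lemma lumpedPow_single_one {n : ℕ} (s : ℕ) {j : ℕ} (hj : j ≤ n) :
    lumpedPow n s (Pi.single 1 1) j = eraseSum n (lumpedPow (n - 1) s (Pi.single 0 1)) j
      - n * lumpedPow n s (Pi.single 0 1) j := by
  induction s generalizing j with
  | zero =>
    simp only [lumpedPow, Function.iterate_zero, id, Pi.single_apply, eraseSum]
    rcases j with _ | _ | j <;> simp
  | succ s ih =>
    have h : ∀ j ≤ n, lumpedPow n s (Pi.single 1 1) j
        = (eraseSum n (lumpedPow (n - 1) s (Pi.single 0 1))
          + (-n : ℝ) • lumpedPow n s (Pi.single 0 1)) j := by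
      intro j hj
      rw [ih hj, Pi.add_apply, Pi.smul_apply, smul_eq_mul]
      ring
    rw [lumpedPow_succ, lumpedPow_succ, lumpedPow_succ, lumpedOp_congr h hj, lumpedOp_add,
      lumpedOp_smul, Pi.add_apply, Pi.smul_apply, smul_eq_mul, lumpedOp_eraseSum hj]
    ring

lemma chiSq_singleton_eq_sum_range {n : ℕ} (hn : 1 ≤ n) (s : ℕ) :
    chiSq n s {n} = (∑ i ∈ range n,
      (((n : ℝ) - i) * (n * (n + 1) * (lumpedPow (n - 1) s (Pi.single 0 1) i
          - lumpedPow n s (Pi.single 0 1) i) - 1) ^ 2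
        + ((i : ℝ) + 1) * (n * (n + 1) * (lumpedPow (n - 1) s (Pi.single 0 1) i
          - lumpedPow n s (Pi.single 0 1) (i + 1)) - 1) ^ 2)) / (n * (n + 1)) := by
  obtain ⟨m, rfl⟩ : ∃ m, n = m + 1 := ⟨n - 1, by omega⟩
  have hx : ({m + 1} : Finset ℕ) ⊆ Icc 1 (m + 1) := by simp
  rw [chiSq_eq_sum hx, Finset.sum_congr rfl fun y hy => by
    rw [Kpow_singleton hn s (mem_powerset.mp hy)]]
  have hI : Icc 1 (m + 1) = insert (m + 1) (Icc 1 m) := by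
    ext i; simp only [mem_Icc, mem_insert]; omega
  have hm : m + 1 ∉ Icc 1 m := by simp
  rw [hI, Finset.sum_powerset_insert hm, ← Finset.sum_add_distrib]
  set u := lumpedPow (m + 1 - 1) s (Pi.single 0 1)
  set v := lumpedPow (m + 1) s (Pi.single 0 1)
  have h := sum_powerset_apply_card (fun i =>
    1 / (((m + 1 : ℕ) : ℝ) + 1) / (m + 1).choose i
      * (((m + 1 : ℕ) : ℝ) * ((m + 1 : ℕ) + 1) * (u i - v i) - 1) ^ 2
    + 1 / (((m + 1 : ℕ) : ℝ) + 1) / (m + 1).choose (i + 1)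
      * (((m + 1 : ℕ) : ℝ) * ((m + 1 : ℕ) + 1) * (u i - v (i + 1)) - 1) ^ 2) (x := Icc 1 m)
  have hpi : piDist (m + 1) {m + 1} = 1 / ((((m + 1 : ℕ) : ℝ) + 1) * (m + 1 : ℕ)) := by
    simp [piDist]
  rw [Finset.sum_congr rfl fun y hy => ?_, h, Nat.card_Icc, Nat.add_sub_cancel, Finset.sum_div]
  · refine Finset.sum_congr rfl fun i hi => ?_
    have hi' : i ≤ m := by simpa [Nat.lt_succ_iff] using hi
    have c0 : (0 : ℝ) < m.choose i := by exact_mod_cast Nat.choose_pos hi'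
    have c1 : (0 : ℝ) < (m + 1).choose i := by exact_mod_cast Nat.choose_pos (by omega)
    have c2 : (0 : ℝ) < (m + 1).choose (i + 1) := by exact_mod_cast Nat.choose_pos (by omega)
    have d1 : (m.choose i : ℝ) * (m + 1) = (m + 1).choose i * (m + 1 - i) := by
      have := Nat.choose_mul_succ_eq m i
      rw [← @Nat.cast_inj ℝ] at this
      push_cast [Nat.cast_sub (show i ≤ m + 1 by omega)] at this
      exact this
    have d2 : ((m : ℝ) + 1) * m.choose i = (m + 1).choose (i + 1) * (i + 1) := by
      exact_mod_cast Nat.add_one_mul_choose_eq m i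
    have e1 : (m.choose i : ℝ) / (m + 1).choose i = (m + 1 - i) / (m + 1) := by
      rw [div_eq_div_iff c1.ne' (by positivity), d1]; ring
    have e2 : (m.choose i : ℝ) / (m + 1).choose (i + 1) = (i + 1) / (m + 1) := by
      rw [div_eq_div_iff c2.ne' (by positivity), mul_comm, d2]; ring
    rw [nsmul_eq_mul]
    push_cast
    set A := (((m : ℝ) + 1) * (m + 1 + 1) * (u i - v i) - 1) ^ 2
    set B := (((m : ℝ) + 1) * (m + 1 + 1) * (u i - v (i + 1)) - 1) ^ 2
    calc _ = ((m.choose i : ℝ) / (m + 1).choose i * A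
          + (m.choose i : ℝ) / (m + 1).choose (i + 1) * B) / (m + 1 + 1) := by ring
      _ = _ := by rw [e1, e2]; field_simp
  · have hy' := mem_powerset.mp hy
    have hmy : m + 1 ∉ y := fun h => hm (hy' h)
    rw [hpi, erase_eq_of_notMem hmy, erase_insert hmy, card_insert_of_notMem hmy]
    simp only [piDist, card_insert_of_notMem hmy, div_div_eq_mul_div, div_one, ← div_div]
    ring

lemma chiSq_singleton {n : ℕ} (hn : 1 ≤ n) (s : ℕ) :
    chiSq n s {n} = (n + 1) * ∑ j ∈ range (n + 1),
        (lumpedPow n s (Pi.single 1 1) j - 1 / ((n : ℝ) + 1)) ^ 2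
      + (n + 1) * ∑ j ∈ range (n + 1), j * ((n : ℝ) - j) *
        (lumpedPow (n - 1) s (Pi.single 0 1) j - lumpedPow (n - 1) s (Pi.single 0 1) (j - 1)) ^ 2 := by
  rw [chiSq_singleton_eq_sum_range hn]
  rw [Finset.sum_congr (s₁ := range (n + 1)) (g := fun j => (eraseSum n
    (lumpedPow (n - 1) s (Pi.single 0 1)) j - n * lumpedPow n s (Pi.single 0 1) j
      - 1 / ((n : ℝ) + 1)) ^ 2) rfl fun j hj => by
        rw [lumpedPow_single_one s (Nat.lt_succ_iff.mp (mem_range.mp hj))]]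
  set u := lumpedPow (n - 1) s (Pi.single 0 1)
  set v := lumpedPow n s (Pi.single 0 1)
  have hn0 : (n : ℝ) ≠ 0 := by positivity
  have key : ∀ f g : ℕ → ℝ, f n = 0 → g 0 = 0 →
      ∑ i ∈ range n, (f i + g (i + 1)) = ∑ j ∈ range (n + 1), (f j + g j) := by
    intro f g hf hg
    rw [Finset.sum_add_distrib, Finset.sum_add_distrib, Finset.sum_range_succ f,
      Finset.sum_range_succ' g, hf, hg, add_zero, add_zero]
  have := key (fun i => ((n : ℝ) - i) * (n * (n + 1) * (u i - v i) - 1) ^ 2)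
    (fun i => (i : ℝ) * (n * (n + 1) * (u (i - 1) - v i) - 1) ^ 2) (by simp) (by simp)
  simp only [Nat.cast_add_one, Nat.add_sub_cancel] at this
  rw [this, Finset.mul_sum, Finset.mul_sum, ← Finset.sum_add_distrib, Finset.sum_div]
  refine Finset.sum_congr rfl fun j _ => ?_
  simp only [eraseSum]
  field_simp
  ring

lemma sum_choose_mul_choose_mul_choose {N a d u : ℕ} (ha : a ≤ N) (hu : u ≤ d) :
    ∑ r ∈ range (d + 1), a.choose r * (N - a).choose (d - r) * r.choose u
      = (N - u).choose (d - u) * a.choose u := by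
  rw [show d + 1 = u + (d - u + 1) by omega, Finset.sum_range_add]
  have h0 : ∑ r ∈ range u, a.choose r * (N - a).choose (d - r) * r.choose u = 0 :=
    Finset.sum_eq_zero fun r hr => by rw [Nat.choose_eq_zero_of_lt (mem_range.mp hr), mul_zero]
  rw [h0, zero_add]
  by_cases hau : u ≤ a
  · rw [show N - u = (a - u) + (N - a) by omega, Nat.add_choose_eq, Finset.sum_mul,
      Nat.sum_antidiagonal_eq_sum_range_succ_mk]
    refine Finset.sum_congr rfl fun r _ => ?_
    by_cases hr : u + r ≤ a
    · have := Nat.choose_mul (n := a) (Nat.le_add_right u r)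
      rw [Nat.add_sub_cancel_left] at this
      simp only [Nat.sub_sub, mul_right_comm _ _ (a.choose u), mul_right_comm _ _ ((u + r).choose u)]
      rw [this, mul_comm (a.choose u)]
    · rw [Nat.choose_eq_zero_of_lt (show a < u + r by omega),
        Nat.choose_eq_zero_of_lt (show a - u < r by omega)]
      simp
  · rw [Nat.choose_eq_zero_of_lt (show a < u by omega), mul_zero]
    exact Finset.sum_eq_zero fun r _ => by
      rw [Nat.choose_eq_zero_of_lt (show a < u + r by omega), zero_mul, zero_mul]

lemma lumpedOp_choose (N d a : ℕ) :
    lumpedOp N (fun j => (j.choose d : ℝ)) a = ∑ r ∈ range (d + 1),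
      (a.choose r : ℝ) * (N - a).choose (d - r) * (arcMoment r * arcMoment (d - r)) := by
  have h : ∀ i j : ℕ, ((i + j).choose d : ℝ)
      = ∑ r ∈ range (d + 1), (i.choose r : ℝ) * j.choose (d - r) := by
    intro i j
    rw [Nat.add_choose_eq, Nat.sum_antidiagonal_eq_sum_range_succ_mk]
    push_cast
    rfl
  simp only [lumpedOp, h, Finset.mul_sum]
  rw [Finset.sum_congr rfl fun i _ => Finset.sum_comm, Finset.sum_comm]
  refine Finset.sum_congr rfl fun r _ => ?_
  calc _ = (∑ i ∈ range (a + 1), a.choose i * arcWeight a i * i.choose r) *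
        ∑ j ∈ range (N - a + 1), (N - a).choose j * arcWeight (N - a) j * j.choose (d - r) := by
        rw [Finset.sum_mul_sum]
        refine Finset.sum_congr rfl fun i _ => Finset.sum_congr rfl fun j _ => ?_
        ring
    _ = _ := by
        rw [sum_choose_mul_arcWeight_mul_choose, sum_choose_mul_arcWeight_mul_choose]
        ring

/-- On the binomial basis the lumped chain is triangular with diagonal `kernelEV`. -/
lemma exists_lumpedOp_choose_eq (N d : ℕ) : ∃ c : ℕ → ℝ, ∀ a ≤ N,
    lumpedOp N (fun j => (j.choose d : ℝ)) a
      = kernelEV d * a.choose d + ∑ u ∈ range d, c u * a.choose u := by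
  let φ : ℕ → ℝ := fun r => arcMoment r * arcMoment (d - r)
  let κ : ℕ → ℝ := fun u => (fwdDiff 1)^[u] φ 0
  have hφ : ∀ r ≤ d, φ r = ∑ u ∈ range (d + 1), r.choose u * κ u := by
    intro r hr
    have h := shift_eq_sum_fwdDiff_iter 1 φ r 0
    simp only [zero_add, smul_eq_mul, mul_one, nsmul_eq_mul] at h
    rw [h]
    refine Finset.sum_subset (range_subset_range.mpr (by omega)) fun u _ hu => ?_
    rw [Nat.choose_eq_zero_of_lt (by simpa using hu)]
    simp
  have hκ : κ d = kernelEV d := by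
    simp only [κ, fwdDiff_iter_eq_sum_shift, kernelEV, φ]
    refine Finset.sum_congr rfl fun r _ => ?_
    simp
  refine ⟨fun u => (N - u).choose (d - u) * κ u, fun a ha => ?_⟩
  rw [lumpedOp_choose]
  calc _ = ∑ r ∈ range (d + 1), ∑ u ∈ range (d + 1),
        κ u * ((a.choose r * (N - a).choose (d - r) * r.choose u : ℕ) : ℝ) := by
        refine Finset.sum_congr rfl fun r hr => ?_
        have := hφ r (Nat.lt_succ_iff.mp (mem_range.mp hr))
        simp only [φ] at this
        rw [this, Finset.mul_sum]
        refine Finset.sum_congr rfl fun u _ => ?_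
        push_cast
        ring
    _ = ∑ u ∈ range (d + 1), κ u * (((N - u).choose (d - u) * a.choose u : ℕ) : ℝ) := by
        rw [Finset.sum_comm]
        refine Finset.sum_congr rfl fun u hu => ?_
        rw [← sum_choose_mul_choose_mul_choose ha (Nat.lt_succ_iff.mp (mem_range.mp hu)),
          ← Finset.mul_sum, Nat.cast_sum]
    _ = _ := by
        rw [Finset.sum_range_succ, hκ, Nat.sub_self, Nat.choose_zero_right, add_comm]
        push_cast
        congr 1
        · ring
        · refine Finset.sum_congr rfl fun u _ => ?_
          ring

/-- The second order difference operator of the discrete Chebyshev polynomials. -/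
noncomputable def chebOp (N : ℕ) (v : ℕ → ℝ) : ℕ → ℝ := fun a =>
  a * ((N : ℝ) + 1 - a) * (v a - v (a - 1)) + ((a : ℝ) + 1) * (N - a) * (v a - v (a + 1))

lemma sum_mul_chebOp (N : ℕ) (f g : ℕ → ℝ) :
    ∑ j ∈ range (N + 1), f j * chebOp N g j
      = ∑ j ∈ range (N + 1), j * ((N : ℝ) + 1 - j) * ((f j - f (j - 1)) * (g j - g (j - 1))) := by
  have h : ∀ M : ℕ, ∑ j ∈ range M, f j * chebOp N g j
      = ∑ j ∈ range M, j * ((N : ℝ) + 1 - j) * ((f j - f (j - 1)) * (g j - g (j - 1)))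
        - f (M - 1) * (M * ((N : ℝ) + 1 - M) * (g M - g (M - 1))) := by
    intro M
    induction M with
    | zero => simp
    | succ M ih =>
      rw [Finset.sum_range_succ, Finset.sum_range_succ, ih, chebOp, Nat.add_sub_cancel]
      push_cast
      ring
  rw [h]
  push_cast
  ring

lemma sum_chebOp_mul (N : ℕ) (f g : ℕ → ℝ) :
    ∑ j ∈ range (N + 1), chebOp N f j * g j = ∑ j ∈ range (N + 1), f j * chebOp N g j := by
  simp only [mul_comm (chebOp N f _)]
  rw [sum_mul_chebOp, sum_mul_chebOp]
  refine Finset.sum_congr rfl fun j _ => ?_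
  ring

lemma chebOp_choose (N d a : ℕ) :
    chebOp N (fun j => (j.choose d : ℝ)) a
      = d * (d + 1) * a.choose d - d * ((N : ℝ) + 1 - d) * a.choose (d - 1) := by
  rcases d with _ | d
  · simp [chebOp]
  have h1 : (a : ℝ) * (a.choose (d + 1) - (a - 1).choose (d + 1)) = (d + 1) * a.choose (d + 1) := by
    rcases a with _ | a
    · simp
    · have h := Nat.add_one_mul_choose_eq a d
      rw [← @Nat.cast_inj ℝ] at h
      push_cast at h
      rw [Nat.add_sub_cancel, mul_comm (d + 1 : ℝ), ← h, Nat.choose_succ_succ a d]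
      push_cast
      ring
  have h2 : ((a : ℝ) + 1) * a.choose d = (d + 1) * (a.choose d + a.choose (d + 1)) := by
    have h := Nat.add_one_mul_choose_eq a d
    rw [Nat.choose_succ_succ a d, ← @Nat.cast_inj ℝ] at h
    push_cast at h
    linarith
  simp only [chebOp, Nat.add_sub_cancel]
  rw [Nat.choose_succ_succ a d] at *
  push_cast at *
  linear_combination ((N : ℝ) + 1 - a) * h1 - (N - a) * h2 + (d + 1) * h2

lemma chebOp_add (N : ℕ) (f g : ℕ → ℝ) : chebOp N (f + g) = chebOp N f + chebOp N g := by
  funext a; simp only [chebOp, Pi.add_apply]; ring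

lemma chebOp_smul (N : ℕ) (c : ℝ) (f : ℕ → ℝ) : chebOp N (c • f) = c • chebOp N f := by
  funext a; simp only [chebOp, Pi.smul_apply, smul_eq_mul]; ring

lemma chebOp_congr {N : ℕ} {f g : ℕ → ℝ} (h : ∀ j ≤ N, f j = g j) {a : ℕ} (ha : a ≤ N) :
    chebOp N f a = chebOp N g a := by
  rw [chebOp, chebOp, h a ha, h (a - 1) (by omega)]
  rcases ha.eq_or_lt with rfl | h'
  · simp
  · rw [h (a + 1) h']

section Triangular

variable {E : Type*} [NormedAddCommGroup E] [InnerProductSpace ℝ E] {M : ℕ}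

/-- A symmetric operator that is triangular in a basis is diagonal in the orthonormal basis
obtained from it by the Gram–Schmidt process. -/
lemma apply_gramSchmidtNormed_eq_smul {b : Fin M → E} {T : E →ₗ[ℝ] E} (hT : T.IsSymmetric)
    {t : Fin M → ℝ} (h : ∀ d, T (b d) - t d • b d ∈ Submodule.span ℝ (b '' Set.Iio d))
    (d : Fin M) :
    T (InnerProductSpace.gramSchmidtNormed ℝ b d)
      = t d • InnerProductSpace.gramSchmidtNormed ℝ b d := by
  set e := InnerProductSpace.gramSchmidtNormed ℝ b with he
  set W := Submodule.span ℝ (b '' Set.Iio d) with hW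
  have hIio : Submodule.span ℝ (e '' Set.Iio d) = W := by
    rw [he, InnerProductSpace.span_gramSchmidtNormed, InnerProductSpace.span_gramSchmidt_Iio]
  have hTW : ∀ w ∈ W, T w ∈ W := by
    intro w hw
    refine Submodule.span_induction ?_ (by simp) (fun x y _ _ hx hy => ?_)
      (fun c x _ hx => ?_) hw
    · rintro _ ⟨i, hi, rfl⟩
      have h1 : T (b i) - t i • b i ∈ W :=
        Submodule.span_mono (Set.image_mono (Set.Iio_subset_Iio (le_of_lt hi))) (h i)
      have h2 : t i • b i ∈ W :=
        W.smul_mem _ (Submodule.subset_span (Set.mem_image_of_mem _ hi))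
      simpa using W.add_mem h1 h2
    · rw [map_add]; exact W.add_mem hx hy
    · rw [map_smul]; exact W.smul_mem _ hx
  have horth : ∀ w ∈ W, inner ℝ w (e d) = 0 := by
    intro w hw
    rw [← hIio] at hw
    refine Submodule.span_induction ?_ (by simp) (fun x y _ _ hx hy => ?_)
      (fun c x _ hx => ?_) hw
    · rintro _ ⟨i, hi, rfl⟩
      simp only [he, InnerProductSpace.gramSchmidtNormed, inner_smul_left, inner_smul_right,
        InnerProductSpace.gramSchmidt_orthogonal ℝ b (ne_of_lt hi), mul_zero]
    · rw [inner_add_left, hx, hy, add_zero]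
    · rw [inner_smul_left, hx, mul_zero]
  have hmem : e d ∈ Submodule.span ℝ (b '' Set.Iic d) := by
    rw [← InnerProductSpace.span_gramSchmidt_Iic, ← InnerProductSpace.span_gramSchmidtNormed]
    exact Submodule.subset_span (Set.mem_image_of_mem _ Set.self_mem_Iic)
  rw [← Set.Iio_insert, Set.image_insert_eq, Submodule.mem_span_insert] at hmem
  obtain ⟨c, w, hw, hc⟩ := hmem
  have hdiff : T (e d) - t d • e d ∈ W := by
    have h1 := W.add_mem (W.smul_mem c (h d)) (W.sub_mem (hTW w hw) (W.smul_mem (t d) hw))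
    convert h1 using 1
    rw [hc, map_add, map_smul]
    module
  have hzero : inner ℝ (T (e d) - t d • e d) (T (e d) - t d • e d) = 0 := by
    have h1 : inner ℝ (T (e d) - t d • e d) (e d) = 0 := horth _ hdiff
    rw [inner_sub_right, inner_smul_right, h1, mul_zero, sub_zero,
      ← hT (T (e d) - t d • e d) (e d)]
    exact horth _ (hTW _ hdiff)
  exact sub_eq_zero.mp (inner_self_eq_zero.mp hzero)

end Triangular

/-- The vector of values of `f` on `{0, …, N}`. -/
noncomputable def toVec (N : ℕ) (f : ℕ → ℝ) : EuclideanSpace ℝ (Fin (N + 1)) :=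
  WithLp.toLp 2 fun i => f i

/-- The extension by zero of a vector to a function on `ℕ`. -/
noncomputable def ofVec {N : ℕ} (v : EuclideanSpace ℝ (Fin (N + 1))) : ℕ → ℝ :=
  fun j => if h : j < N + 1 then v ⟨j, h⟩ else 0

lemma inner_toVec (N : ℕ) (f g : ℕ → ℝ) :
    inner ℝ (toVec N f) (toVec N g) = ∑ j ∈ range (N + 1), f j * g j := by
  rw [PiLp.inner_apply, Finset.sum_range]
  refine Finset.sum_congr rfl fun i _ => ?_
  simp [toVec, mul_comm]

lemma toVec_ofVec {N : ℕ} (v : EuclideanSpace ℝ (Fin (N + 1))) : toVec N (ofVec v) = v := by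
  ext i
  simp only [toVec, ofVec, i.2, dite_true]

lemma toVec_congr {N : ℕ} {f g : ℕ → ℝ} : toVec N f = toVec N g ↔ ∀ j ≤ N, f j = g j := by
  constructor
  · intro h j hj
    have := congrArg (fun v : EuclideanSpace ℝ (Fin (N + 1)) => v ⟨j, Nat.lt_succ_of_le hj⟩) h
    simpa [toVec] using this
  · intro h
    ext i
    exact h i (Nat.lt_succ_iff.mp i.2)

lemma toVec_add (N : ℕ) (f g : ℕ → ℝ) : toVec N (f + g) = toVec N f + toVec N g := rfl

lemma toVec_smul (N : ℕ) (c : ℝ) (f : ℕ → ℝ) : toVec N (c • f) = c • toVec N f := rfl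

/-- The linear map on vectors induced by an operator on functions on `{0, …, N}`. -/
noncomputable def vecOp (N : ℕ) (A : (ℕ → ℝ) → ℕ → ℝ) (hadd : ∀ f g, A (f + g) = A f + A g)
    (hsmul : ∀ (c : ℝ) f, A (c • f) = c • A f) :
    EuclideanSpace ℝ (Fin (N + 1)) →ₗ[ℝ] EuclideanSpace ℝ (Fin (N + 1)) where
  toFun v := toVec N (A (ofVec v))
  map_add' v w := by
    rw [← toVec_add, ← hadd]
    congr 2
    funext j
    by_cases h : j < N + 1 <;> simp [ofVec, h]
  map_smul' c v := by
    rw [RingHom.id_apply, ← toVec_smul, ← hsmul]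
    congr 2
    funext j
    by_cases h : j < N + 1 <;> simp [ofVec, h]

lemma linearIndependent_toVec_choose (N : ℕ) :
    LinearIndependent ℝ fun d : Fin (N + 1) => toVec N fun j => (j.choose d : ℝ) := by
  rw [Fintype.linearIndependent_iff]
  intro g hg
  have h : ∀ a (ha : a < N + 1), g ⟨a, ha⟩ = 0 := by
    intro a
    induction a using Nat.strong_induction_on with
    | _ a ih =>
      intro ha
      have h1 := congrArg (fun v : EuclideanSpace ℝ (Fin (N + 1)) => v ⟨a, ha⟩) hg
      simp only [toVec, WithLp.ofLp_sum, WithLp.ofLp_smul, Finset.sum_apply, Pi.smul_apply,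
        smul_eq_mul, PiLp.zero_apply] at h1
      rw [Finset.sum_eq_single ⟨a, ha⟩] at h1
      · simpa using h1
      · intro i _ hi
        rcases lt_trichotomy i.1 a with hlt | heq | hgt
        · rw [ih i.1 hlt i.2, zero_mul]
        · exact absurd (Fin.ext heq) hi
        · rw [Nat.choose_eq_zero_of_lt hgt, Nat.cast_zero, mul_zero]
      · simp
  exact fun i => h i.1 i.2

/-- An operator which is symmetric on `{0, …, N}` and triangular on the binomial basis acts
diagonally on the Gram–Schmidt basis. -/
lemma apply_ofVec_gramSchmidtNormed (N : ℕ) (A : (ℕ → ℝ) → ℕ → ℝ)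
    (hadd : ∀ f g, A (f + g) = A f + A g) (hsmul : ∀ (c : ℝ) f, A (c • f) = c • A f)
    (hcongr : ∀ f g : ℕ → ℝ, (∀ j ≤ N, f j = g j) → ∀ a ≤ N, A f a = A g a)
    (hsymm : ∀ f g, ∑ j ∈ range (N + 1), A f j * g j = ∑ j ∈ range (N + 1), f j * A g j)
    (t : ℕ → ℝ) (htri : ∀ d, ∃ c : ℕ → ℝ, ∀ a ≤ N,
      A (fun j => (j.choose d : ℝ)) a = t d * a.choose d + ∑ u ∈ range d, c u * a.choose u)
    (d : Fin (N + 1)) : ∀ j ≤ N,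
    A (ofVec (InnerProductSpace.gramSchmidtNormed ℝ
      (fun d : Fin (N + 1) => toVec N fun j => (j.choose d : ℝ)) d)) j
      = t d * ofVec (InnerProductSpace.gramSchmidtNormed ℝ
      (fun d : Fin (N + 1) => toVec N fun j => (j.choose d : ℝ)) d) j := by
  set b : Fin (N + 1) → EuclideanSpace ℝ (Fin (N + 1)) :=
    fun d => toVec N fun j => (j.choose d : ℝ) with hb
  have hofto : ∀ f : ℕ → ℝ, ∀ j ≤ N, ofVec (toVec N f) j = f j :=
    fun f => toVec_congr.mp (toVec_ofVec (toVec N f))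
  have hT : (vecOp N A hadd hsmul).IsSymmetric := by
    intro v w
    have h := hsymm (ofVec v) (ofVec w)
    rw [← inner_toVec, ← inner_toVec, toVec_ofVec, toVec_ofVec] at h
    exact h
  have key := apply_gramSchmidtNormed_eq_smul hT (b := b) (t := fun d => t d) ?_ d
  · refine toVec_congr.mp ?_
    refine Eq.trans key ?_
    nth_rw 1 [← toVec_ofVec (InnerProductSpace.gramSchmidtNormed ℝ b d)]
    rfl
  · intro d
    obtain ⟨c, hc⟩ := htri d
    have h : vecOp N A hadd hsmul (b d) - t d • b d = ∑ u : Fin d.1, c u • b ⟨u, u.2.trans d.2⟩ := by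
      rw [sub_eq_iff_eq_add]
      have h1 : vecOp N A hadd hsmul (b d)
          = toVec N (fun a => t d * a.choose d + ∑ u ∈ range d, c u * a.choose u) := by
        refine toVec_congr.mpr fun a ha => ?_
        rw [← hc a ha]
        exact hcongr _ _ (hofto _) a ha
      rw [h1]
      ext i
      simp [hb, toVec, Finset.sum_range, add_comm]
    rw [h]
    refine Submodule.sum_mem _ fun u _ => Submodule.smul_mem _ _ (Submodule.subset_span ?_)
    exact Set.mem_image_of_mem _ u.2

/-- The lumped chain and the Chebyshev difference operator are simultaneously diagonalized by an
orthonormal basis of the functions on `{0, …, N}`. -/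
lemma exists_eigenbasis (N : ℕ) : ∃ e : ℕ → ℕ → ℝ,
    (∀ f g : ℕ → ℝ, ∑ j ∈ range (N + 1), f j * g j = ∑ d ∈ range (N + 1),
      (∑ j ∈ range (N + 1), f j * e d j) * ∑ j ∈ range (N + 1), g j * e d j) ∧
    (∀ d ≤ N, ∀ j ≤ N, lumpedOp N (e d) j = kernelEV d * e d j) ∧
    (∀ d ≤ N, ∀ j ≤ N, chebOp N (e d) j = (d : ℝ) * (d + 1) * e d j) := by
  set b : Fin (N + 1) → EuclideanSpace ℝ (Fin (N + 1)) :=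
    fun d => toVec N fun j => (j.choose d : ℝ) with hb
  have hli : LinearIndependent ℝ b := linearIndependent_toVec_choose N
  set E := InnerProductSpace.gramSchmidtOrthonormalBasis (𝕜 := ℝ) (f := b)
    (by simp : Module.finrank ℝ (EuclideanSpace ℝ (Fin (N + 1))) = Fintype.card (Fin (N + 1)))
  have hEb : ∀ d, E d = InnerProductSpace.gramSchmidtNormed ℝ b d := fun d =>
    InnerProductSpace.gramSchmidtOrthonormalBasis_apply _
      (by
        have := InnerProductSpace.gramSchmidtNormed_unit_length (𝕜 := ℝ) d hli
        rw [← norm_ne_zero_iff, this]; exact one_ne_zero)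
  let e : ℕ → ℕ → ℝ := fun d => if h : d < N + 1 then ofVec (E ⟨d, h⟩) else 0
  have he : ∀ d (h : d < N + 1), e d
      = ofVec (InnerProductSpace.gramSchmidtNormed ℝ b ⟨d, h⟩) := fun d h => by
    simp only [e, h, dite_true, hEb]
  refine ⟨e, fun f g => ?_, fun d hd => ?_, fun d hd => ?_⟩
  · rw [← inner_toVec, ← E.sum_inner_mul_inner, Finset.sum_range]
    refine Finset.sum_congr rfl fun d _ => ?_
    rw [← inner_toVec, ← inner_toVec, he d.1 d.2, toVec_ofVec, hEb, real_inner_comm _ (toVec N g)]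
  · rw [he d (Nat.lt_succ_of_le hd)]
    exact apply_ofVec_gramSchmidtNormed N (lumpedOp N) (lumpedOp_add N) (lumpedOp_smul N)
      (fun f g h a ha => lumpedOp_congr h ha) (sum_lumpedOp_mul N) kernelEV
      (exists_lumpedOp_choose_eq N) ⟨d, Nat.lt_succ_of_le hd⟩
  · rw [he d (Nat.lt_succ_of_le hd)]
    refine apply_ofVec_gramSchmidtNormed N (chebOp N) (chebOp_add N) (chebOp_smul N)
      (fun f g h a ha => chebOp_congr h ha) (sum_chebOp_mul N) (fun d => (d : ℝ) * (d + 1))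
      (fun d => ⟨fun u => if u + 1 = d then -(d * ((N : ℝ) + 1 - d)) else 0, fun a _ => ?_⟩)
      ⟨d, Nat.lt_succ_of_le hd⟩
    rw [chebOp_choose]
    rcases d with _ | d
    · simp
    · have h : ∀ u ∈ range d, u ≠ d := fun u hu => (mem_range.mp hu).ne
      simp only [Nat.add_right_cancel_iff, ite_mul, zero_mul]
      rw [Finset.sum_range_succ, Finset.sum_eq_zero fun u hu => if_neg (h u hu), if_pos rfl,
        Nat.add_sub_cancel]
      ring

lemma sum_lumpedPow_mul {N s : ℕ} {e f : ℕ → ℝ} {κ : ℝ}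
    (he : ∀ j ≤ N, lumpedOp N e j = κ * e j) :
    ∑ j ∈ range (N + 1), lumpedPow N s f j * e j = κ ^ s * ∑ j ∈ range (N + 1), f j * e j := by
  induction s with
  | zero => simp [lumpedPow]
  | succ s ih =>
    rw [lumpedPow_succ, sum_lumpedOp_mul, pow_succ', mul_assoc, ← ih, Finset.mul_sum]
    refine Finset.sum_congr rfl fun j hj => ?_
    rw [he j (Nat.lt_succ_iff.mp (mem_range.mp hj))]
    ring

lemma sum_chebOp_mul_of_eigen {N : ℕ} {e f : ℕ → ℝ} {μ : ℝ}
    (he : ∀ j ≤ N, chebOp N e j = μ * e j) :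
    ∑ j ∈ range (N + 1), chebOp N f j * e j = μ * ∑ j ∈ range (N + 1), f j * e j := by
  rw [sum_chebOp_mul, Finset.mul_sum]
  refine Finset.sum_congr rfl fun j hj => ?_
  rw [he j (Nat.lt_succ_iff.mp (mem_range.mp hj))]
  ring

lemma sum_mul_eq_zero_of_eigen {N : ℕ} {e f : ℕ → ℝ} {μ ν : ℝ} (hμν : μ ≠ ν)
    (he : ∀ j ≤ N, chebOp N e j = μ * e j) (hf : ∀ j ≤ N, chebOp N f j = ν * f j) :
    ∑ j ∈ range (N + 1), f j * e j = 0 := by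
  have h1 := sum_chebOp_mul_of_eigen (f := f) he
  have h2 : ∑ j ∈ range (N + 1), chebOp N f j * e j = ν * ∑ j ∈ range (N + 1), f j * e j := by
    rw [Finset.mul_sum]
    refine Finset.sum_congr rfl fun j hj => ?_
    rw [hf j (Nat.lt_succ_iff.mp (mem_range.mp hj))]
    ring
  have h3 : (μ - ν) * ∑ j ∈ range (N + 1), f j * e j = 0 := by linarith
  exact (mul_eq_zero.mp h3).resolve_left (sub_ne_zero.mpr hμν)

/-- The discrete Chebyshev polynomial of degree two. -/
noncomputable def chebTwo (N : ℕ) : ℕ → ℝ := fun j => 6 * (j : ℝ) ^ 2 - 6 * N * j + N * (N - 1)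

lemma chebOp_chebTwo (N j : ℕ) : chebOp N (chebTwo N) j = 6 * chebTwo N j := by
  rcases j with _ | j
  · simp only [chebOp, chebTwo]; push_cast; ring
  · simp only [chebOp, chebTwo, Nat.add_sub_cancel]; push_cast; ring

lemma chebOp_const (N : ℕ) (c : ℝ) (j : ℕ) : chebOp N (fun _ => c) j = 0 := by simp [chebOp]

lemma sum_chebTwo (N : ℕ) : ∑ j ∈ range (N + 1), chebTwo N j = 0 := by
  have := sum_mul_eq_zero_of_eigen (N := N) (e := chebTwo N) (f := fun _ => 1) (μ := 6) (ν := 0)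
    (by norm_num) (fun j _ => chebOp_chebTwo N j) (fun j _ => by rw [chebOp_const]; ring)
  simpa using this

lemma sum_range_pow_four_closed (M : ℕ) : ∑ j ∈ range M, (j : ℝ) ^ 4
    = (M - 1) * M * (2 * M - 1) * (3 * M ^ 2 - 3 * M - 1) / 30 := by
  induction M with
  | zero => simp
  | succ M ih => rw [Finset.sum_range_succ, ih]; push_cast; ring

lemma sum_range_pow_three_closed (M : ℕ) : ∑ j ∈ range M, (j : ℝ) ^ 3
    = (M * (M - 1) / 2) ^ 2 := by
  induction M with
  | zero => simp
  | succ M ih => rw [Finset.sum_range_succ, ih]; push_cast; ring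

lemma sum_range_pow_two_closed (M : ℕ) : ∑ j ∈ range M, (j : ℝ) ^ 2
    = (M - 1) * M * (2 * M - 1) / 6 := by
  induction M with
  | zero => simp
  | succ M ih => rw [Finset.sum_range_succ, ih]; push_cast; ring

lemma sum_range_cast_closed (M : ℕ) : ∑ j ∈ range M, (j : ℝ) = M * (M - 1) / 2 := by
  induction M with
  | zero => simp
  | succ M ih => rw [Finset.sum_range_succ, ih]; push_cast; ring

lemma sum_chebTwo_sq (N : ℕ) : ∑ j ∈ range (N + 1), chebTwo N j ^ 2
    = N * ((N : ℝ) - 1) * (N + 1) * (N + 2) * (N + 3) / 5 := by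
  have h : ∀ j : ℕ, chebTwo N j ^ 2 = 36 * (j : ℝ) ^ 4 - 72 * N * (j : ℝ) ^ 3
      + (36 * (N : ℝ) ^ 2 + 12 * N * (N - 1)) * (j : ℝ) ^ 2
      - 12 * (N : ℝ) ^ 2 * (N - 1) * j + (N : ℝ) ^ 2 * (N - 1) ^ 2 := by
    intro j; simp only [chebTwo]; ring
  simp only [h, Finset.sum_add_distrib, Finset.sum_sub_distrib, ← Finset.mul_sum]
  rw [sum_range_pow_four_closed, sum_range_pow_three_closed, sum_range_pow_two_closed,
    sum_range_cast_closed, Finset.sum_const, card_range, nsmul_eq_mul]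
  push_cast
  ring

lemma sum_lumpedPow_mul_chebTwo {N : ℕ} (s : ℕ) (f : ℕ → ℝ) :
    ∑ j ∈ range (N + 1), lumpedPow N s f j * chebTwo N j
      = (1 / 4) ^ s * ∑ j ∈ range (N + 1), f j * chebTwo N j := by
  obtain ⟨e, hpars, hR, hL⟩ := exists_eigenbasis N
  rw [hpars, hpars f, Finset.mul_sum]
  refine Finset.sum_congr rfl fun d hd => ?_
  have hd' := Nat.lt_succ_iff.mp (mem_range.mp hd)
  rw [sum_lumpedPow_mul (hR d hd')]
  by_cases h2 : d = 2
  · rw [h2, kernelEV_two, mul_assoc]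
  · have hne : (d : ℝ) * (d + 1) ≠ 6 := by
      intro h
      have h' : d * (d + 1) = 6 := by exact_mod_cast h
      rcases Nat.lt_or_ge d 2 with h3 | h3
      · nlinarith
      · have h4 : 3 ≤ d := by omega
        nlinarith
    rw [sum_mul_eq_zero_of_eigen hne (hL d hd') (fun j _ => chebOp_chebTwo N j)]
    ring

/-- The Dirichlet form of `chebOp`. -/
noncomputable def dirichlet (N : ℕ) (f : ℕ → ℝ) : ℝ :=
  ∑ j ∈ range (N + 1), j * ((N : ℝ) + 1 - j) * (f j - f (j - 1)) ^ 2

lemma dirichlet_eq (N : ℕ) (f : ℕ → ℝ) :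
    dirichlet N f = ∑ j ∈ range (N + 1), f j * chebOp N f j := by
  rw [sum_mul_chebOp]
  simp only [dirichlet, sq]

lemma dirichlet_nonneg (N : ℕ) (f : ℕ → ℝ) : 0 ≤ dirichlet N f := by
  refine Finset.sum_nonneg fun j hj => ?_
  have : (j : ℝ) ≤ N := by exact_mod_cast Nat.lt_succ_iff.mp (mem_range.mp hj)
  have : (0 : ℝ) ≤ (N : ℝ) + 1 - j := by linarith
  positivity

/-- The Poincaré type inequality for `chebOp` tested against an eigenfunction. -/
lemma eigen_mul_sq_le_dirichlet {N : ℕ} {f q : ℕ → ℝ} {μ : ℝ}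
    (hq : ∀ j ≤ N, chebOp N q j = μ * q j) :
    μ * (∑ j ∈ range (N + 1), f j * q j) ^ 2
      ≤ dirichlet N f * ∑ j ∈ range (N + 1), q j ^ 2 := by
  set S := ∑ j ∈ range (N + 1), q j ^ 2 with hS
  set P := ∑ j ∈ range (N + 1), f j * q j with hP
  have hS0 : 0 ≤ S := Finset.sum_nonneg fun j _ => sq_nonneg _
  rcases hS0.eq_or_lt with h0 | hpos
  · have hz : P = 0 := by
      refine Finset.sum_eq_zero fun j hj => ?_
      have := (Finset.sum_eq_zero_iff_of_nonneg fun j _ => sq_nonneg (q j)).mp h0.symm j hj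
      rw [pow_eq_zero_iff two_ne_zero] at this
      rw [this, mul_zero]
    rw [hz, ← h0]; simp
  have h1 := dirichlet_nonneg N (S • f + (-P) • q)
  have h2 : dirichlet N (S • f + (-P) • q) = S ^ 2 * dirichlet N f - μ * P ^ 2 * S := by
    have e1 : ∑ j ∈ range (N + 1), chebOp N f j * q j = μ * P := sum_chebOp_mul_of_eigen hq
    have e2 : ∑ j ∈ range (N + 1), chebOp N q j * q j = μ * S := by
      rw [sum_chebOp_mul_of_eigen hq, hS]; simp only [sq]
    have e3 : ∑ j ∈ range (N + 1), f j * chebOp N q j = μ * P := by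
      rw [← sum_chebOp_mul, e1]
    rw [dirichlet_eq, dirichlet_eq, chebOp_add, chebOp_smul, chebOp_smul]
    simp only [Pi.add_apply, Pi.smul_apply, smul_eq_mul]
    calc _ = S ^ 2 * ∑ j ∈ range (N + 1), f j * chebOp N f j
          - S * P * ∑ j ∈ range (N + 1), f j * chebOp N q j
          - S * P * ∑ j ∈ range (N + 1), chebOp N f j * q j
          + P ^ 2 * ∑ j ∈ range (N + 1), chebOp N q j * q j := by
          simp only [Finset.mul_sum, ← Finset.sum_sub_distrib, ← Finset.sum_add_distrib]
          refine Finset.sum_congr rfl fun j _ => ?_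
          ring
      _ = _ := by rw [e1, e2, e3]; ring
  rw [h2] at h1
  have h3 : 0 ≤ S * (dirichlet N f * S - μ * P ^ 2) := by linarith
  linarith [nonneg_of_mul_nonneg_right h3 hpos]

lemma dirichlet_lumpedPow_lower (N s : ℕ) :
    6 * ((1 / 4) ^ s * (N * ((N : ℝ) - 1))) ^ 2
      ≤ dirichlet N (lumpedPow N s (Pi.single 0 1)) *
        (N * ((N : ℝ) - 1) * (N + 1) * (N + 2) * (N + 3) / 5) := by
  have h := eigen_mul_sq_le_dirichlet (f := lumpedPow N s (Pi.single 0 1))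
    (fun j _ => chebOp_chebTwo N j)
  rw [sum_chebTwo_sq, sum_lumpedPow_mul_chebTwo] at h
  convert h using 4
  simp [Pi.single_apply, chebTwo]

lemma sum_lumpedPow_single_one_lower {n : ℕ} (hn : 1 ≤ n) (s : ℕ) :
    ((1 / 4) ^ s * (((n : ℝ) - 1) * (n - 6))) ^ 2
      ≤ (∑ j ∈ range (n + 1), (lumpedPow n s (Pi.single 1 1) j - 1 / ((n : ℝ) + 1)) ^ 2) *
        (n * ((n : ℝ) - 1) * (n + 1) * (n + 2) * (n + 3) / 5) := by
  rw [← sum_chebTwo_sq]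
  refine le_trans (le_of_eq ?_) (Finset.sum_mul_sq_le_sq_mul_sq _ _ _)
  congr 1
  simp only [sub_mul, Finset.sum_sub_distrib]
  rw [← Finset.mul_sum, sum_chebTwo, mul_zero, sub_zero, sum_lumpedPow_mul_chebTwo]
  congr 1
  simp only [Pi.single_apply, ite_mul, one_mul, zero_mul]
  rw [Finset.sum_ite_eq' , if_pos (mem_range.mpr (by omega)), chebTwo]
  push_cast
  ring

/-- The harmonic numbers, as real numbers. -/
noncomputable def harm (j : ℕ) : ℝ := ∑ i ∈ range j, 1 / ((i : ℝ) + 1)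

lemma harm_succ (j : ℕ) : harm (j + 1) = harm j + 1 / ((j : ℝ) + 1) := Finset.sum_range_succ _ _

lemma sum_harm (M : ℕ) : ∑ j ∈ range M, harm j = M * (harm M - 1) := by
  induction M with
  | zero => simp
  | succ M ih => rw [Finset.sum_range_succ, ih, harm_succ]; push_cast; field_simp; ring

lemma sum_harm_sq (M : ℕ) :
    ∑ j ∈ range M, harm j ^ 2 = M * harm M ^ 2 - (2 * M + 1) * harm M + 2 * M := by
  induction M with
  | zero => simp [harm]
  | succ M ih => rw [Finset.sum_range_succ, ih, harm_succ]; push_cast; field_simp; ring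

lemma sum_mul_harm (M : ℕ) :
    ∑ j ∈ range M, (j : ℝ) * harm j = M * (M - 1) / 2 * harm M - M * (M - 1) / 4 := by
  induction M with
  | zero => simp
  | succ M ih => rw [Finset.sum_range_succ, ih, harm_succ]; push_cast; field_simp; ring

lemma le_harm (M : ℕ) : 3 * (M : ℝ) / (2 * (M + 1)) ≤ harm M := by
  induction M with
  | zero => simp [harm]
  | succ M ih =>
    rw [harm_succ]
    refine le_trans ?_ (add_le_add_left ih _)
    push_cast
    rw [div_add_div _ _ (by positivity) (by positivity), div_le_div_iff₀ (by positivity)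
      (by positivity)]
    have : (0 : ℝ) ≤ M := by positivity
    nlinarith [mul_nonneg this this, mul_nonneg (mul_nonneg this this) this]

/-- The Green function of `chebOp` at `0`, corrected by an affine function. -/
noncomputable def greenFn (N : ℕ) : ℕ → ℝ := fun j =>
  -(harm j - (harm (N + 1) - 1) - 3 / ((N : ℝ) + 2) * (j - N / 2)) / (N + 1)

lemma chebOp_greenFn (N j : ℕ) : chebOp N (greenFn N) j
    = Pi.single (M := fun _ => ℝ) 0 1 j - 1 / ((N : ℝ) + 1)
      + 3 / (((N : ℝ) + 1) * (N + 2)) * (2 * j - N) := by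
  rcases j with _ | j
  · simp only [chebOp, greenFn, harm_succ, Pi.single_eq_same]
    push_cast
    field_simp
    ring
  · simp only [chebOp, greenFn, Nat.add_sub_cancel, harm_succ, Pi.single_apply,
      Nat.add_one_ne_zero, if_false]
    push_cast
    field_simp
    ring

lemma sum_greenFn_sq_le (N : ℕ) :
    ∑ j ∈ range (N + 1), greenFn N j ^ 2 ≤ 1 / (4 * ((N : ℝ) + 1)) := by
  set b : ℝ := 3 / ((N : ℝ) + 2) with hb
  set h := harm (N + 1) with hh
  have e : ∀ j : ℕ, greenFn N j ^ 2 = (harm j ^ 2 - 2 * b * (j * harm j)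
      - 2 * (h - 1 - b * N / 2) * harm j + b ^ 2 * (j : ℝ) ^ 2
      + 2 * b * (h - 1 - b * N / 2) * j + (h - 1 - b * N / 2) ^ 2) / ((N : ℝ) + 1) ^ 2 := by
    intro j
    simp only [greenFn, ← hb, ← hh]
    rw [div_pow]
    congr 1
    ring
  have hs : ∑ j ∈ range (N + 1), greenFn N j ^ 2 = ((N : ℝ) + 1 - h - 2 * b * ((N + 1) * N / 4)
      + b ^ 2 * ((N + 1) * N * (N + 2) / 12)) / ((N : ℝ) + 1) ^ 2 := by
    simp only [e]
    rw [← Finset.sum_div]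
    congr 1
    simp only [Finset.sum_add_distrib, Finset.sum_sub_distrib, ← Finset.mul_sum]
    rw [sum_harm, sum_harm_sq, sum_mul_harm, sum_range_pow_two_closed, sum_range_cast_closed,
      Finset.sum_const, card_range, nsmul_eq_mul, ← hh]
    push_cast
    ring
  have hle := le_harm (N + 1)
  rw [← hh] at hle
  rw [hs, div_le_div_iff₀ (by positivity) (by positivity), hb]
  have hb' : 2 * (3 / ((N : ℝ) + 2)) * ((N + 1) * N / 4)
      - (3 / ((N : ℝ) + 2)) ^ 2 * ((N + 1) * N * (N + 2) / 12)
      = 3 * ((N : ℝ) + 1) / 4 - 3 * ((N + 1 : ℕ) : ℝ) / (2 * ((N + 1 : ℕ) + 1)) := by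
    push_cast
    field_simp
    ring
  have hN : (0 : ℝ) < (N : ℝ) + 1 := by positivity
  nlinarith

lemma sum_single_zero_mul_eigen {N d : ℕ} {e : ℕ → ℝ}
    (he : ∀ j ≤ N, chebOp N e j = (d : ℝ) * (d + 1) * e j) (h1 : d ≠ 1) :
    ∑ j ∈ range (N + 1), (Pi.single (M := fun _ => ℝ) 0 1 j - 1 / ((N : ℝ) + 1)) * e j
      = (d : ℝ) * (d + 1) * ∑ j ∈ range (N + 1), greenFn N j * e j := by
  have hne : (d : ℝ) * (d + 1) ≠ 2 := by
    intro h
    have h' : d * (d + 1) = 2 := by exact_mod_cast h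
    rcases Nat.lt_or_ge d 2 with h3 | h3
    · interval_cases d <;> simp_all
    · nlinarith
  have hz := sum_mul_eq_zero_of_eigen (f := fun j => 2 * (j : ℝ) - N) (ν := 2) hne he
    (fun j _ => by
      rcases j with _ | j
      · simp only [chebOp]; push_cast; ring
      · simp only [chebOp, Nat.add_sub_cancel]; push_cast; ring)
  rw [← sum_chebOp_mul_of_eigen he]
  have hz' : ∑ j ∈ range (N + 1), 3 / (((N : ℝ) + 1) * (N + 2)) * ((2 * (j : ℝ) - N) * e j) = 0 := by
    rw [← Finset.mul_sum, hz, mul_zero]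
  rw [← add_zero (∑ j ∈ range (N + 1), _ * e j), ← hz', ← Finset.sum_add_distrib]
  refine Finset.sum_congr rfl fun j _ => ?_
  rw [chebOp_greenFn]
  ring

lemma sum_const_mul_eigen {N d : ℕ} {e : ℕ → ℝ}
    (he : ∀ j ≤ N, chebOp N e j = (d : ℝ) * (d + 1) * e j) (h0 : d ≠ 0) (c : ℝ) :
    ∑ j ∈ range (N + 1), c * e j = 0 :=
  sum_mul_eq_zero_of_eigen (f := fun _ => c) (ν := 0) (by positivity) he
    (fun j _ => by rw [chebOp_const, zero_mul])

lemma dirichlet_lumpedPow_upper (N : ℕ) {s : ℕ} (hs : 3 ≤ s) :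
    dirichlet N (lumpedPow N s (Pi.single 0 1)) ≤ 360 * (1 / 4) ^ (2 * s) / (4 * ((N : ℝ) + 1)) := by
  obtain ⟨e, hpars, hR, hL⟩ := exists_eigenbasis N
  calc dirichlet N (lumpedPow N s (Pi.single 0 1))
      ≤ 360 * (1 / 4) ^ (2 * s) * ∑ j ∈ range (N + 1), greenFn N j * greenFn N j := by
        rw [dirichlet_eq, hpars, hpars (greenFn N), Finset.mul_sum]
        refine Finset.sum_le_sum fun d hd => ?_
        have hd' := Nat.lt_succ_iff.mp (mem_range.mp hd)
        rw [sum_chebOp_mul_of_eigen (hL d hd'), sum_lumpedPow_mul (hR d hd')]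
        set w := ∑ j ∈ range (N + 1), greenFn N j * e d j
        have hr : 0 ≤ 360 * (1 / 4 : ℝ) ^ (2 * s) * (w * w) :=
          mul_nonneg (by positivity) (mul_self_nonneg w)
        by_cases h0 : d = 0
        · subst h0; simpa using hr
        by_cases h1 : d = 1
        · have : kernelEV d = 0 := kernelEV_of_odd (by rw [h1]; norm_num)
          rw [this, zero_pow (by omega)]
          simpa using hr
        have hw := sum_single_zero_mul_eigen (hL d hd') h1
        simp only [sub_mul, Finset.sum_sub_distrib] at hw
        rw [sum_const_mul_eigen (hL d hd') h0, sub_zero] at hw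
        rw [hw]
        have hk := mul_le_mul_of_nonneg_right (kernelEV_pow_le d s hs) (mul_self_nonneg w)
        refine le_trans (le_of_eq ?_) hk
        ring
    _ ≤ 360 * (1 / 4) ^ (2 * s) * (1 / (4 * ((N : ℝ) + 1))) := by
        have h := sum_greenFn_sq_le N
        simp only [sq] at h
        gcongr
    _ = _ := by ring

lemma chebOp_single_zero (N j : ℕ) : chebOp N (Pi.single 0 1) j
    = N * (Pi.single (M := fun _ => ℝ) 0 1 j - Pi.single (M := fun _ => ℝ) 1 1 j) := by
  rcases j with _ | _ | j <;> simp [chebOp]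

lemma one_sub_div_sq_le {x n : ℝ} (hn : 3 ≤ n) (h1 : 6 ≤ x) (h2 : x ≤ n * (n + 1)) :
    (1 - x / n) ^ 2 ≤ x * ((n + 1) / n) := by
  have hn0 : 0 < n := by linarith
  rw [one_sub_div hn0.ne', div_pow, mul_div_assoc', div_le_div_iff₀ (by positivity) hn0]
  have h : (n - x) ^ 2 ≤ x * (n + 1) * n := by
    nlinarith [mul_nonneg (sub_nonneg.mpr h1) (sub_nonneg.mpr h2),
      mul_nonneg (sub_nonneg.mpr hn) (sub_nonneg.mpr h1), mul_pos hn0 hn0]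
  calc (n - x) ^ 2 * n ≤ x * (n + 1) * n * n := by gcongr
    _ = _ := by ring

lemma sum_lumpedPow_single_one_upper {n : ℕ} (hn : 3 ≤ n) {s : ℕ} (hs : 3 ≤ s) :
    ∑ j ∈ range (n + 1), (lumpedPow n s (Pi.single 1 1) j - 1 / ((n : ℝ) + 1)) ^ 2
      ≤ 360 * (1 / 4) ^ (2 * s) / (4 * (n : ℝ)) := by
  obtain ⟨e, hpars, hR, hL⟩ := exists_eigenbasis n
  have hn' : (3 : ℝ) ≤ n := by exact_mod_cast hn
  calc ∑ j ∈ range (n + 1), (lumpedPow n s (Pi.single 1 1) j - 1 / ((n : ℝ) + 1)) ^ 2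
      ≤ 360 * (1 / 4) ^ (2 * s) * (((n : ℝ) + 1) / n)
        * ∑ j ∈ range (n + 1), greenFn n j * greenFn n j := by
        simp only [sq (lumpedPow n s (Pi.single 1 1) _ - 1 / ((n : ℝ) + 1))]
        rw [hpars, hpars (greenFn n), Finset.mul_sum]
        refine Finset.sum_le_sum fun d hd => ?_
        have hd' := Nat.lt_succ_iff.mp (mem_range.mp hd)
        simp only [sub_mul, Finset.sum_sub_distrib]
        rw [sum_lumpedPow_mul (hR d hd')]
        set w := ∑ j ∈ range (n + 1), greenFn n j * e d j
        have hr : 0 ≤ 360 * (1 / 4 : ℝ) ^ (2 * s) * (((n : ℝ) + 1) / n) * (w * w) :=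
          mul_nonneg (by positivity) (mul_self_nonneg w)
        have h01 : ∑ j ∈ range (n + 1), (Pi.single (M := fun _ => ℝ) 1 1 j) * e d j
            = (1 - (d : ℝ) * (d + 1) / n)
              * ∑ j ∈ range (n + 1), (Pi.single (M := fun _ => ℝ) 0 1 j) * e d j := by
          have h := sum_chebOp_mul_of_eigen (f := Pi.single 0 1) (hL d hd')
          simp only [chebOp_single_zero, mul_assoc, sub_mul] at h
          rw [← Finset.mul_sum, Finset.sum_sub_distrib] at h
          field_simp
          linarith
        by_cases h1 : d = 1
        · have : kernelEV d = 0 := kernelEV_of_odd (by rw [h1]; norm_num)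
          rw [this, zero_pow (by omega), sum_const_mul_eigen (hL d hd') (by omega)]
          simpa using hr
        have hw := sum_single_zero_mul_eigen (hL d hd') h1
        simp only [sub_mul, Finset.sum_sub_distrib] at hw
        by_cases h0 : d = 0
        · subst h0
          rw [Nat.cast_zero, zero_mul, zero_mul, sub_eq_zero] at hw
          rw [h01, kernelEV_zero, one_pow, ← hw]
          simpa using hr
        rw [sum_const_mul_eigen (hL d hd') h0, sub_zero] at hw
        rw [sum_const_mul_eigen (hL d hd') h0, sub_zero, h01, hw]
        have hd2 : (2 : ℝ) ≤ d := by exact_mod_cast (show 2 ≤ d by omega)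
        have hdn : (d : ℝ) ≤ n := by exact_mod_cast hd'
        have hq := one_sub_div_sq_le (x := (d : ℝ) * (d + 1)) hn' (by nlinarith) (by nlinarith)
        have hk := kernelEV_pow_le d s hs
        have hκ : 0 ≤ kernelEV d ^ (2 * s) := pow_nonneg (kernelEV_nonneg d) _
        calc _ = (1 - (d : ℝ) * (d + 1) / n) ^ 2
              * (((d : ℝ) * (d + 1)) ^ 2 * kernelEV d ^ (2 * s) * (w * w)) := by ring
          _ ≤ ((d : ℝ) * (d + 1) * (((n : ℝ) + 1) / n))
              * (((d : ℝ) * (d + 1)) ^ 2 * kernelEV d ^ (2 * s) * (w * w)) :=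
              mul_le_mul_of_nonneg_right hq
                (mul_nonneg (mul_nonneg (sq_nonneg _) hκ) (mul_self_nonneg w))
          _ = (((d : ℝ) * (d + 1)) ^ 3 * kernelEV d ^ (2 * s))
              * ((((n : ℝ) + 1) / n) * (w * w)) := by ring
          _ ≤ (360 * (1 / 4) ^ (2 * s)) * ((((n : ℝ) + 1) / n) * (w * w)) :=
              mul_le_mul_of_nonneg_right hk (mul_nonneg (by positivity) (mul_self_nonneg w))
          _ = _ := by ring
    _ ≤ 360 * (1 / 4) ^ (2 * s) * (((n : ℝ) + 1) / n) * (1 / (4 * ((n : ℝ) + 1))) := by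
        have h := sum_greenFn_sq_le n
        simp only [sq] at h
        gcongr
    _ = _ := by field_simp

lemma chiSq_singleton_eq_dirichlet {n : ℕ} (hn : 1 ≤ n) (s : ℕ) :
    chiSq n s {n} = (n + 1) * ∑ j ∈ range (n + 1),
        (lumpedPow n s (Pi.single 1 1) j - 1 / ((n : ℝ) + 1)) ^ 2
      + (n + 1) * dirichlet (n - 1) (lumpedPow (n - 1) s (Pi.single 0 1)) := by
  rw [chiSq_singleton hn, Finset.sum_range_succ (fun j : ℕ => (j : ℝ) * ((n : ℝ) - j) * _), sub_self,
    mul_zero, zero_mul, add_zero, dirichlet, Nat.sub_add_cancel hn, Nat.cast_sub hn, Nat.cast_one,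
    sub_add_cancel]

lemma chiSq_singleton_upper {n s : ℕ} (hn : 3 ≤ n) (hs : 3 ≤ s) :
    chiSq n s {n} ≤ 270 * (1 / 4 : ℝ) ^ (2 * s) := by
  have hn' : (3 : ℝ) ≤ n := by exact_mod_cast hn
  have h0 := sum_lumpedPow_single_one_upper hn hs
  have h1 := dirichlet_lumpedPow_upper (n - 1) hs
  rw [Nat.cast_sub (by omega), Nat.cast_one, sub_add_cancel] at h1
  rw [chiSq_singleton_eq_dirichlet (by omega)]
  calc _ ≤ ((n : ℝ) + 1) * (360 * (1 / 4) ^ (2 * s) / (4 * n))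
        + (n + 1) * (360 * (1 / 4) ^ (2 * s) / (4 * n)) := by gcongr
    _ = (180 * ((n : ℝ) + 1) / n) * (1 / 4) ^ (2 * s) := by ring
    _ ≤ _ := by
        gcongr
        rw [div_le_iff₀ (by linarith)]
        linarith

lemma chiSq_singleton_lower {n : ℕ} (hn : 3 ≤ n) (s : ℕ) :
    5 * (1 / 4 : ℝ) ^ (2 * s) ≤ chiSq n s {n} := by
  have hn' : (3 : ℝ) ≤ n := by exact_mod_cast hn
  have h0 := sum_lumpedPow_single_one_lower (show 1 ≤ n by omega) s
  have h1 := dirichlet_lumpedPow_lower (n - 1) s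
  rw [Nat.cast_sub (by omega), Nat.cast_one] at h1
  rw [chiSq_singleton_eq_dirichlet (by omega)]
  set P := ∑ j ∈ range (n + 1), (lumpedPow n s (Pi.single 1 1) j - 1 / ((n : ℝ) + 1)) ^ 2
  set D := dirichlet (n - 1) (lumpedPow (n - 1) s (Pi.single 0 1))
  rw [mul_pow, ← pow_mul, mul_comm s 2] at h0 h1
  have hX : 0 < (1 / 4 : ℝ) ^ (2 * s) := by positivity
  set X := (1 / 4 : ℝ) ^ (2 * s)
  have hD : 30 * ((n : ℝ) - 1) * (n - 2) * X ≤ (n + 1) * D * (n * (n + 2)) := by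
    have hpos : 0 < ((n : ℝ) - 1) * (n - 2) / 5 := by
      have : (0 : ℝ) < n - 1 := by linarith
      have : (0 : ℝ) < n - 2 := by linarith
      positivity
    refine le_of_mul_le_mul_right (le_trans (le_of_eq ?_) (h1.trans (le_of_eq ?_))) hpos <;> ring
  rcases hn.eq_or_lt with rfl | h4
  · norm_num at h0 hD ⊢
    linarith
  · have h4' : (4 : ℝ) ≤ n := by exact_mod_cast h4
    have hP : 0 ≤ P := Finset.sum_nonneg fun j _ => sq_nonneg _
    have hc : 5 * ((n : ℝ) * (n + 2)) ≤ 30 * ((n : ℝ) - 1) * (n - 2) := by nlinarith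
    have h5 : 5 * X * (n * (n + 2)) ≤ (n + 1) * D * (n * (n + 2)) := by
      nlinarith [mul_le_mul_of_nonneg_right hc hX.le]
    have h6 : 5 * X ≤ (n + 1) * D := le_of_mul_le_mul_right h5 (by positivity)
    nlinarith

/-- For the binary Burnside process started from the state with a single 1 in
the last coordinate, for all n, s ≥ 3, 5·(1/4)^{2s} ≤ χ²_{e_n}(s) ≤ 270·(1/4)^{2s}. -/
theorem burnside_chiSq_from_one_one (n s : ℕ) (hn : 3 ≤ n) (hs : 3 ≤ s) :
    5 * (1 / 4 : ℝ) ^ (2 * s) ≤ chiSq n s {n} ∧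
      chiSq n s {n} ≤ 270 * (1 / 4 : ℝ) ^ (2 * s) :=
  ⟨chiSq_singleton_lower hn s, chiSq_singleton_upper hn hs⟩
end

section
/- For every subset S ⊆ {1,…,n}: if |S| = 2k is even, then K_n f_S = β_k f_S with β_k = C(2k,k)²/16^k; if |S| is odd, then K_n f_S = 0. -/
open Finset

attribute [local instance] Classical.propDecidable

/-- The central binomial coefficient as a real number. -/
noncomputable def realCentralBinom (a : ℕ) : ℝ := (2 * a).choose a

/-- The probability that an urn driven by the arcsine law produces a given sequence with
`a` zeros and `b` ones. -/
noncomputable def arcsineWeight (a b : ℕ) : ℝ :=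
  realCentralBinom a * realCentralBinom b / (4 ^ (a + b) * (a + b).choose a)

theorem realCentralBinom_succ (a : ℕ) :
    ((a : ℝ) + 1) * realCentralBinom (a + 1) = 2 * (2 * a + 1) * realCentralBinom a := by
  have h := Nat.succ_mul_centralBinom_succ a
  simp only [Nat.centralBinom] at h
  unfold realCentralBinom
  exact_mod_cast h

theorem realCentralBinom_zero : realCentralBinom 0 = 1 := by simp [realCentralBinom]

theorem arcsineWeight_eq_factorial (a b : ℕ) :
    arcsineWeight a b = realCentralBinom a * a.factorial * (realCentralBinom b * b.factorial) /
      (4 ^ (a + b) * (a + b).factorial) := by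
  have h : ((a + b).choose a : ℝ) * a.factorial * b.factorial = (a + b).factorial := by
    rw [Nat.choose_symm_add]
    exact_mod_cast Nat.add_choose_mul_factorial_mul_factorial a b
  have h0 : ((a + b).choose a : ℝ) ≠ 0 :=
    Nat.cast_ne_zero.2 (Nat.choose_pos (Nat.le_add_right a b)).ne'
  have ha : (a.factorial : ℝ) ≠ 0 := Nat.cast_ne_zero.2 a.factorial_ne_zero
  have hb : (b.factorial : ℝ) ≠ 0 := Nat.cast_ne_zero.2 b.factorial_ne_zero
  rw [arcsineWeight, ← h]
  field_simp

theorem arcsineWeight_add (a b : ℕ) :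
    arcsineWeight (a + 1) b + arcsineWeight a (b + 1) = arcsineWeight a b := by
  have hn : ((a + b).factorial : ℝ) ≠ 0 := Nat.cast_ne_zero.2 (a + b).factorial_ne_zero
  have hc : (a : ℝ) + b + 1 ≠ 0 := by positivity
  have ha := realCentralBinom_succ a
  have hb := realCentralBinom_succ b
  simp only [arcsineWeight_eq_factorial, show a + 1 + b = a + b + 1 by ring,
    show a + (b + 1) = a + b + 1 by ring, Nat.factorial_succ]
  push_cast
  rw [← add_div, div_eq_div_iff (by positivity) (by positivity)]
  linear_combination
    4 ^ (a + b) * ((a + b).factorial : ℝ) * a.factorial * b.factorial *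
      (realCentralBinom b * ha + realCentralBinom a * hb)

theorem choose_mul_arcsineWeight (a b : ℕ) :
    ((a + b).choose a : ℝ) * arcsineWeight b a =
      realCentralBinom a * realCentralBinom b / 4 ^ (a + b) := by
  have h0 : ((a + b).choose a : ℝ) ≠ 0 :=
    Nat.cast_ne_zero.2 (Nat.choose_pos (Nat.le_add_right a b)).ne'
  rw [arcsineWeight, add_comm b a, ← Nat.choose_symm_add]
  field_simp

theorem sum_powerset_union_of_disjoint {α : Type*} [DecidableEq α] {A B : Finset α}
    (h : Disjoint A B) (F : Finset α → ℝ) :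
    ∑ y ∈ (A ∪ B).powerset, F y = ∑ a ∈ A.powerset, ∑ b ∈ B.powerset, F (a ∪ b) := by
  rw [← Finset.sum_product']
  refine Finset.sum_nbij' (fun y => (y ∩ A, y ∩ B)) (fun z => z.1 ∪ z.2) ?_ ?_ ?_ ?_ ?_
  · simp
  · intro z hz
    simp only [mem_product, mem_powerset] at hz ⊢
    exact union_subset_union hz.1 hz.2
  · intro y hy
    rw [← inter_union_distrib_left]
    exact inter_eq_left.2 (mem_powerset.1 hy)
  · rintro ⟨a, b⟩ hz
    simp only [mem_product, mem_powerset] at hz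
    have h1 : b ∩ A = ∅ := disjoint_iff_inter_eq_empty.1 (h.symm.mono_left hz.2)
    have h2 : a ∩ B = ∅ := disjoint_iff_inter_eq_empty.1 (h.mono_left hz.1)
    simp [union_inter_distrib_right, h1, h2, inter_eq_left.2 hz.1, inter_eq_left.2 hz.2]
  · intro y hy
    rw [← inter_union_distrib_left, inter_eq_left.2 (mem_powerset.1 hy)]

theorem sum_powerset_arcsineWeight {α : Type*} [DecidableEq α] (B : Finset α) (a b : ℕ) :
    ∑ y ∈ B.powerset, arcsineWeight (a + (B \ y).card) (b + y.card) = arcsineWeight a b := by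
  induction B using Finset.induction_on generalizing a b with
  | empty => simp
  | insert i B hi ih =>
    rw [sum_powerset_insert hi, ← arcsineWeight_add a b, ← ih (a + 1) b, ← ih a (b + 1)]
    congr 1 <;> refine sum_congr rfl fun y hy => ?_
    · have hy' : i ∉ y := fun h => hi (mem_powerset.1 hy h)
      rw [insert_sdiff_of_notMem _ hy', card_insert_of_notMem (by simp [hi])]
      congr 1
      ring
    · have hy' : i ∉ y := fun h => hi (mem_powerset.1 hy h)
      rw [insert_sdiff_insert, card_insert_of_notMem hy', sdiff_insert_of_notMem hi]
      congr 1
      ring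

theorem sum_powerset_arcsineWeight_mul {α : Type*} [DecidableEq α] (A S : Finset α)
    (φ : ℕ → ℝ) :
    ∑ y ∈ A.powerset, arcsineWeight (A \ y).card y.card * φ (S ∩ y).card =
      (∑ z ∈ antidiagonal (S ∩ A).card, realCentralBinom z.1 * realCentralBinom z.2 * φ z.1) /
        4 ^ (S ∩ A).card := by
  have hd : Disjoint (S ∩ A) (A \ S) := by
    rw [disjoint_left]; intro x; simp; tauto
  have hA : A = (S ∩ A) ∪ (A \ S) := by ext x; simp; tauto
  have key : ∀ a ∈ (S ∩ A).powerset,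
      ∑ b ∈ (A \ S).powerset,
        arcsineWeight (A \ (a ∪ b)).card (a ∪ b).card * φ (S ∩ (a ∪ b)).card =
      arcsineWeight ((S ∩ A).card - a.card) a.card * φ a.card := by
    intro a ha
    have ha' := mem_powerset.1 ha
    rw [← sum_powerset_arcsineWeight (A \ S), sum_mul]
    refine sum_congr rfl fun b hb => ?_
    have hb' := mem_powerset.1 hb
    have hab : Disjoint a b := hd.mono ha' hb'
    have h1 : S ∩ (a ∪ b) = a := by
      ext x
      have := @ha' x
      have := @hb' x
      simp at *
      tauto
    have h2 : A \ (a ∪ b) = ((S ∩ A) \ a) ∪ ((A \ S) \ b) := by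
      ext x
      have := @ha' x
      have := @hb' x
      simp at *
      tauto
    rw [h1, h2, card_union_of_disjoint hab,
      card_union_of_disjoint (hd.mono sdiff_subset sdiff_subset), card_sdiff_of_subset ha']
  conv_lhs => rw [show A.powerset = ((S ∩ A) ∪ (A \ S)).powerset by rw [← hA]]
  rw [sum_powerset_union_of_disjoint hd, sum_congr rfl key,
    sum_powerset_apply_card (fun i => arcsineWeight ((S ∩ A).card - i) i * φ i),
    Finset.Nat.sum_antidiagonal_eq_sum_range_succ_mk, sum_div]
  refine sum_congr rfl fun i hi => ?_
  obtain ⟨j, hj⟩ := Nat.exists_eq_add_of_le (Nat.lt_succ_iff.1 (mem_range.1 hi))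
  have := choose_mul_arcsineWeight i j
  simp only [hj, Nat.add_sub_cancel_left, nsmul_eq_mul, ← mul_assoc, this]
  ring

/-- The quantity `4 ^ (p + q) * K_n f_S U` for `p = |S ∩ U|` and `q = |S \ U|`. -/
noncomputable def quadSum (p q : ℕ) : ℝ :=
  ∑ z ∈ antidiagonal p, realCentralBinom z.1 * realCentralBinom z.2 *
    ∑ w ∈ antidiagonal q, realCentralBinom w.1 * realCentralBinom w.2 *
      ((-1) ^ (z.1 + w.1) * (p + q).choose (z.1 + w.1))

theorem succ_mul_sum_antidiagonal (p : ℕ) (F : ℕ → ℝ) :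
    ((p : ℝ) + 1) * ∑ z ∈ antidiagonal (p + 1),
        realCentralBinom z.1 * realCentralBinom z.2 * F z.1 =
      ∑ z ∈ antidiagonal p, realCentralBinom z.1 * realCentralBinom z.2 *
        (2 * (2 * z.1 + 1) * F (z.1 + 1) + 2 * (2 * z.2 + 1) * F z.1) := by
  have h : ((p : ℝ) + 1) * ∑ z ∈ antidiagonal (p + 1),
        realCentralBinom z.1 * realCentralBinom z.2 * F z.1 =
      ∑ z ∈ antidiagonal (p + 1), z.1 * realCentralBinom z.1 * (realCentralBinom z.2 * F z.1) +
      ∑ z ∈ antidiagonal (p + 1), z.2 * realCentralBinom z.2 * (realCentralBinom z.1 * F z.1) := by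
    rw [mul_sum, ← sum_add_distrib]
    refine sum_congr rfl fun z hz => ?_
    have : (z.1 : ℝ) + z.2 = p + 1 := by exact_mod_cast mem_antidiagonal.1 hz
    rw [← this]
    ring
  rw [h, Finset.Nat.sum_antidiagonal_succ, Finset.Nat.sum_antidiagonal_succ']
  simp only [Nat.cast_zero, zero_mul, zero_add, Nat.cast_add, Nat.cast_one,
    realCentralBinom_succ]
  rw [← sum_add_distrib]
  exact sum_congr rfl fun z _ => by ring

theorem succ_mul_quadSum_add (p q : ℕ) :
    ((p : ℝ) + 1) * quadSum (p + 1) q + ((q : ℝ) + 1) * quadSum p (q + 1) = 0 := by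
  have h1 := succ_mul_sum_antidiagonal p (fun i => ∑ w ∈ antidiagonal q,
    realCentralBinom w.1 * realCentralBinom w.2 *
      ((-1) ^ (i + w.1) * (p + q + 1).choose (i + w.1)))
  have h2 : ((q : ℝ) + 1) * quadSum p (q + 1) = ∑ z ∈ antidiagonal p,
      realCentralBinom z.1 * realCentralBinom z.2 * ∑ w ∈ antidiagonal q,
        realCentralBinom w.1 * realCentralBinom w.2 *
        (2 * (2 * w.1 + 1) * ((-1) ^ (z.1 + (w.1 + 1)) * (p + q + 1).choose (z.1 + (w.1 + 1))) +
        2 * (2 * w.2 + 1) * ((-1) ^ (z.1 + w.1) * (p + q + 1).choose (z.1 + w.1))) := by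
    rw [quadSum, mul_sum]
    refine sum_congr rfl fun z _ => ?_
    rw [mul_left_comm]
    congr 1
    exact succ_mul_sum_antidiagonal q
      (fun j => (-1) ^ (z.1 + j) * (p + q + 1).choose (z.1 + j))
  rw [quadSum, show p + 1 + q = p + q + 1 by ring, h1, h2, ← sum_add_distrib]
  refine sum_eq_zero fun z hz => ?_
  rw [← mul_add, mul_sum, mul_sum, ← sum_add_distrib, ← sum_add_distrib]
  refine mul_eq_zero_of_right _ (sum_eq_zero fun w hw => ?_)
  have hz' : (z.1 : ℝ) + z.2 = p := by exact_mod_cast mem_antidiagonal.1 hz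
  have hw' : (w.1 : ℝ) + w.2 = q := by exact_mod_cast mem_antidiagonal.1 hw
  have hle : z.1 + w.1 ≤ p + q + 1 := by
    have := mem_antidiagonal.1 hz
    have := mem_antidiagonal.1 hw
    omega
  have hc : ((p + q + 1).choose (z.1 + w.1 + 1) : ℝ) * (z.1 + w.1 + 1) =
      (p + q + 1).choose (z.1 + w.1) * (z.2 + w.2 + 1) := by
    have := Nat.choose_succ_right_eq (p + q + 1) (z.1 + w.1)
    rw [← @Nat.cast_inj ℝ] at this
    push_cast [Nat.cast_sub hle] at this
    rw [this, ← hz', ← hw']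
    ring
  rw [show z.1 + 1 + w.1 = z.1 + w.1 + 1 by ring, show z.1 + (w.1 + 1) = z.1 + w.1 + 1 by ring,
    pow_succ]
  linear_combination
    -4 * realCentralBinom w.1 * realCentralBinom w.2 * (-1) ^ (z.1 + w.1) * hc

theorem quadSum_eq (p q : ℕ) :
    quadSum p q = (-1) ^ p * (p + q).choose p * quadSum 0 (p + q) := by
  induction p generalizing q with
  | zero => simp
  | succ p ih =>
    have h := succ_mul_quadSum_add p q
    rw [ih, show p + (q + 1) = p + 1 + q by ring] at h
    have hc : ((p + 1 + q).choose (p + 1) : ℝ) * (p + 1) = (p + 1 + q).choose p * (q + 1) := by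
      have := Nat.choose_succ_right_eq (p + 1 + q) p
      rw [show p + 1 + q - p = q + 1 by omega] at this
      exact_mod_cast this
    have hp : (p : ℝ) + 1 ≠ 0 := by positivity
    apply mul_left_cancel₀ hp
    rw [pow_succ]
    linear_combination h + (-1) ^ p * quadSum 0 (p + 1 + q) * hc

/-- The alternating convolution square of the central binomial coefficients. -/
noncomputable def altConv (l : ℕ) : ℝ :=
  ∑ z ∈ antidiagonal l, (-1) ^ z.2 * (realCentralBinom z.1 * realCentralBinom z.2)

theorem altConv_add_two (l : ℕ) :
    ((l : ℝ) + 2) * altConv (l + 2) = 16 * (l + 1) * altConv l := by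
  set D := PowerSeries.derivative ℝ
  set A : PowerSeries ℝ := PowerSeries.mk realCentralBinom with hA
  set B : PowerSeries ℝ := PowerSeries.mk (fun n => (-1) ^ n * realCentralBinom n) with hB
  have ofNat_eq (k : ℕ) [k.AtLeastTwo] :
      (OfNat.ofNat k : PowerSeries ℝ) = PowerSeries.C (OfNat.ofNat k : ℝ) :=
    (map_ofNat _ k).symm
  have hAd : D A = 4 * (PowerSeries.X * D A) + 2 * A := by
    ext n
    have h := realCentralBinom_succ n
    rw [ofNat_eq, ofNat_eq, map_add, PowerSeries.coeff_C_mul, PowerSeries.coeff_C_mul]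
    cases n with
    | zero =>
      simp only [D, hA, PowerSeries.coeff_derivative, PowerSeries.coeff_mk,
        PowerSeries.coeff_zero_X_mul]
      linear_combination h
    | succ n =>
      simp only [D, hA, PowerSeries.coeff_derivative, PowerSeries.coeff_mk,
        PowerSeries.coeff_succ_X_mul]
      push_cast at h ⊢
      linear_combination h
  have hBd : D B = -(4 * (PowerSeries.X * D B)) - 2 * B := by
    ext n
    have h := realCentralBinom_succ n
    rw [ofNat_eq, ofNat_eq, map_sub, map_neg, PowerSeries.coeff_C_mul, PowerSeries.coeff_C_mul]
    cases n with
    | zero =>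
      simp only [D, hB, PowerSeries.coeff_derivative, PowerSeries.coeff_mk,
        PowerSeries.coeff_zero_X_mul]
      linear_combination -h
    | succ n =>
      simp only [D, hB, PowerSeries.coeff_derivative, PowerSeries.coeff_mk,
        PowerSeries.coeff_succ_X_mul]
      push_cast at h ⊢
      linear_combination -(-1) ^ (n + 1) * h
  have hE : ∀ n, PowerSeries.coeff n (A * B) = altConv n := by
    intro n
    rw [PowerSeries.coeff_mul, altConv]
    refine sum_congr rfl fun z _ => ?_
    rw [hA, hB, PowerSeries.coeff_mk, PowerSeries.coeff_mk]
    ring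
  have hD : D (A * B) = 16 * (PowerSeries.X * (PowerSeries.X * D (A * B) + A * B)) := by
    rw [Derivation.leibniz, smul_eq_mul, smul_eq_mul]
    linear_combination A * (1 - 4 * PowerSeries.X) * hBd + B * (1 + 4 * PowerSeries.X) * hAd
  have h := congrArg (PowerSeries.coeff (l + 1)) hD
  rw [ofNat_eq, PowerSeries.coeff_C_mul, PowerSeries.coeff_succ_X_mul, map_add, hE,
    PowerSeries.coeff_derivative, hE] at h
  push_cast at h
  cases l with
  | zero =>
    rw [PowerSeries.coeff_zero_X_mul] at h
    push_cast
    linear_combination h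
  | succ l =>
    rw [PowerSeries.coeff_succ_X_mul, PowerSeries.coeff_derivative, hE] at h
    push_cast at h ⊢
    linear_combination h

theorem altConv_odd (s : ℕ) : altConv (2 * s + 1) = 0 := by
  induction s with
  | zero => simp [altConv, Finset.Nat.sum_antidiagonal_succ, mul_comm]
  | succ s ih =>
    have h := altConv_add_two (2 * s + 1)
    rw [ih, mul_zero] at h
    exact (mul_eq_zero.1 h).resolve_left (by positivity)

theorem altConv_even (s : ℕ) : altConv (2 * s) = 4 ^ s * realCentralBinom s := by
  induction s with
  | zero => simp [altConv, realCentralBinom_zero]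
  | succ s ih =>
    have h := altConv_add_two (2 * s)
    rw [ih] at h
    have hc := realCentralBinom_succ s
    push_cast at h
    have h0 : (2 : ℝ) * s + 2 ≠ 0 := by positivity
    apply mul_left_cancel₀ h0
    rw [show 2 * (s + 1) = 2 * s + 2 by ring, h, pow_succ]
    linear_combination -8 * 4 ^ s * hc

theorem sum_neg_one_pow_mul_quadSum (m : ℕ) :
    ∑ x ∈ antidiagonal m, (-1) ^ x.1 * quadSum x.1 x.2 =
      ∑ y ∈ antidiagonal m, m.choose y.1 * (altConv y.1 * altConv y.2) := by
  have hL : ∑ x ∈ antidiagonal m, (-1) ^ x.1 * quadSum x.1 x.2 =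
      ∑ x ∈ antidiagonal m, ∑ t ∈ antidiagonal x.1 ×ˢ antidiagonal x.2,
        (-1) ^ (t.1.2 + t.2.1) * m.choose (t.1.1 + t.2.1) *
          (realCentralBinom t.1.1 * realCentralBinom t.1.2 *
            (realCentralBinom t.2.1 * realCentralBinom t.2.2)) := by
    refine sum_congr rfl fun x hx => ?_
    rw [quadSum, mul_sum, sum_product]
    refine sum_congr rfl fun z hz => ?_
    rw [mul_sum, mul_sum]
    refine sum_congr rfl fun w _ => ?_
    rw [mem_antidiagonal.1 hx, ← mem_antidiagonal.1 hz]
    have : ((-1 : ℝ) ^ z.1) * (-1) ^ z.1 = 1 := by rw [← mul_pow]; simp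
    simp only [pow_add]
    linear_combination (-1) ^ z.2 * (-1) ^ w.1 * m.choose (z.1 + w.1) *
          (realCentralBinom z.1 * realCentralBinom z.2 *
            (realCentralBinom w.1 * realCentralBinom w.2)) * this
  have hR : ∑ y ∈ antidiagonal m, m.choose y.1 * (altConv y.1 * altConv y.2) =
      ∑ y ∈ antidiagonal m, ∑ t ∈ antidiagonal y.1 ×ˢ antidiagonal y.2,
        (-1) ^ (t.2.2 + t.1.2) * m.choose (t.1.1 + t.1.2) *
          (realCentralBinom t.1.1 * realCentralBinom t.2.2 *
            (realCentralBinom t.1.2 * realCentralBinom t.2.1)) := by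
    refine sum_congr rfl fun y _ => ?_
    rw [altConv, altConv, sum_mul_sum, sum_product, mul_sum]
    refine sum_congr rfl fun z hz => ?_
    rw [mul_sum]
    refine sum_congr rfl fun w _ => ?_
    rw [mem_antidiagonal.1 hz, pow_add]
    ring
  rw [hL, hR, sum_sigma', sum_sigma']
  refine sum_nbij'
    (fun s => ⟨(s.2.1.1 + s.2.2.1, s.2.1.2 + s.2.2.2),
      ((s.2.1.1, s.2.2.1), (s.2.2.2, s.2.1.2))⟩)
    (fun s => ⟨(s.2.1.1 + s.2.2.2, s.2.1.2 + s.2.2.1),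
      ((s.2.1.1, s.2.2.2), (s.2.1.2, s.2.2.1))⟩) ?_ ?_ ?_ ?_ ?_
  · rintro ⟨⟨p, q⟩, ⟨i, i'⟩, ⟨j, j'⟩⟩ h
    simp at h ⊢
    omega
  · rintro ⟨⟨p, q⟩, ⟨i, i'⟩, ⟨j, j'⟩⟩ h
    simp at h ⊢
    omega
  · rintro ⟨⟨p, q⟩, ⟨i, i'⟩, ⟨j, j'⟩⟩ h
    simp at h
    obtain ⟨-, rfl, rfl⟩ := h
    rfl
  · rintro ⟨⟨p, q⟩, ⟨i, i'⟩, ⟨j, j'⟩⟩ h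
    simp at h
    obtain ⟨-, rfl, rfl⟩ := h
    simp [add_comm]
  · rintro ⟨⟨p, q⟩, ⟨i, i'⟩, ⟨j, j'⟩⟩ h
    rfl

theorem two_pow_mul_quadSum_zero (m : ℕ) :
    2 ^ m * quadSum 0 m =
      ∑ y ∈ antidiagonal m, m.choose y.1 * (altConv y.1 * altConv y.2) := by
  rw [← sum_neg_one_pow_mul_quadSum]
  have h : ∀ x ∈ antidiagonal m,
      (-1) ^ x.1 * quadSum x.1 x.2 = m.choose x.1 * quadSum 0 m := by
    intro x hx
    rw [quadSum_eq, mem_antidiagonal.1 hx]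
    have : ((-1 : ℝ) ^ x.1) * (-1) ^ x.1 = 1 := by rw [← mul_pow]; simp
    linear_combination m.choose x.1 * quadSum 0 m * this
  rw [sum_congr rfl h, ← sum_mul,
    Finset.Nat.sum_antidiagonal_eq_sum_range_succ_mk]
  congr 1
  exact_mod_cast (Nat.sum_range_choose m).symm

theorem quadSum_zero_odd (k : ℕ) : quadSum 0 (2 * k + 1) = 0 := by
  have h := two_pow_mul_quadSum_zero (2 * k + 1)
  rw [sum_eq_zero] at h
  · exact (mul_eq_zero.1 h).resolve_left (by positivity)
  · intro y hy
    have hy' := mem_antidiagonal.1 hy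
    rcases Nat.even_or_odd' y.1 with ⟨s, hs | hs⟩
    · have : y.2 = 2 * (k - s) + 1 := by omega
      rw [this, altConv_odd]
      simp
    · rw [hs, altConv_odd]
      simp

theorem sum_range_two_mul_of_odd_eq_zero (f : ℕ → ℝ) (hf : ∀ s, f (2 * s + 1) = 0) (k : ℕ) :
    ∑ l ∈ range (2 * k + 1), f l = ∑ s ∈ range (k + 1), f (2 * s) := by
  induction k with
  | zero => simp
  | succ k ih =>
    rw [sum_range_succ _ (k + 1), ← ih, show 2 * (k + 1) + 1 = 2 * k + 1 + 1 + 1 by ring,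
      sum_range_succ, sum_range_succ, hf]
    simp [mul_add]

theorem choose_two_mul_mul_realCentralBinom (s t : ℕ) :
    ((2 * (s + t)).choose (2 * s) : ℝ) * (realCentralBinom s * realCentralBinom t) =
      realCentralBinom (s + t) * ((s + t).choose s : ℝ) ^ 2 := by
  simp only [realCentralBinom]
  rw [Nat.cast_choose ℝ (show 2 * s ≤ 2 * (s + t) by omega),
    Nat.cast_choose ℝ (show s ≤ 2 * s by omega), Nat.cast_choose ℝ (show t ≤ 2 * t by omega),
    Nat.cast_choose ℝ (show s + t ≤ 2 * (s + t) by omega),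
    Nat.cast_choose ℝ (show s ≤ s + t by omega),
    show 2 * (s + t) - 2 * s = 2 * t by omega, show 2 * s - s = s by omega,
    show 2 * t - t = t by omega, show 2 * (s + t) - (s + t) = s + t by omega,
    show s + t - s = t by omega]
  have h (a : ℕ) : (a.factorial : ℝ) ≠ 0 := Nat.cast_ne_zero.2 a.factorial_ne_zero
  have := h s
  have := h t
  have := h (s + t)
  have := h (2 * s)
  have := h (2 * t)
  field_simp

theorem quadSum_zero_even (k : ℕ) : quadSum 0 (2 * k) = realCentralBinom k ^ 2 := by
  have h := two_pow_mul_quadSum_zero (2 * k)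
  rw [Finset.Nat.sum_antidiagonal_eq_sum_range_succ_mk, Nat.succ_eq_add_one,
    sum_range_two_mul_of_odd_eq_zero _ (fun s => by simp [altConv_odd])] at h
  have h2 : ∀ s ∈ range (k + 1), ((2 * k).choose (2 * s) : ℝ) *
      (altConv (2 * s) * altConv (2 * k - 2 * s)) =
      4 ^ k * realCentralBinom k * ((k.choose s : ℕ) ^ 2 : ℕ) := by
    intro s hs
    obtain ⟨t, rfl⟩ := Nat.exists_eq_add_of_le (Nat.lt_succ_iff.1 (mem_range.1 hs))
    rw [show 2 * (s + t) - 2 * s = 2 * t by omega, altConv_even, altConv_even, pow_add]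
    push_cast
    linear_combination 4 ^ s * 4 ^ t * choose_two_mul_mul_realCentralBinom s t
  rw [sum_congr rfl h2, ← mul_sum, ← Nat.cast_sum, Nat.sum_range_choose_sq, pow_mul] at h
  norm_num [mul_assoc] at h
  rw [h, realCentralBinom, sq]

theorem Kmat_eq_arcsineWeight_mul {n : ℕ} {x y : Finset ℕ} (hx : x ⊆ Icc 1 n)
    (hy : y ⊆ Icc 1 n) :
    Kmat n x y = arcsineWeight ((Icc 1 n \ x) \ y).card (y \ x).card *
      arcsineWeight (x \ y).card (x ∩ y).card := by
  have h1 : ((Icc 1 n \ x) \ y).card = n - (x ∪ y).card := by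
    rw [sdiff_sdiff_left, sup_eq_union, card_sdiff_of_subset (union_subset hx hy)]
    simp
  have h2 : (x \ y).card + (x ∩ y).card = x.card := card_sdiff_add_card_inter x y
  have h3 : (x ∪ y).card = x.card + (y \ x).card := by
    rw [← union_sdiff_self_eq_union, card_union_of_disjoint disjoint_sdiff]
  have h4 : (x ∪ y).card ≤ n := by
    simpa using card_le_card (union_subset hx hy)
  have h5 : n = (n - (x ∪ y).card + (y \ x).card) + ((x \ y).card + (x ∩ y).card) := by omega
  have h6 : (4 : ℝ) ^ n = 4 ^ (n - (x ∪ y).card + (y \ x).card) *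
      4 ^ ((x \ y).card + (x ∩ y).card) := by
    rw [← pow_add, ← h5]
  rw [h1, Kmat, arcsineWeight, arcsineWeight, div_mul_div_comm, h6]
  simp only [realCentralBinom]
  congr 1 <;> ring

theorem Kop_fSvec_eq_quadSum {n : ℕ} {S U : Finset ℕ} (hS : S ⊆ Icc 1 n) (hU : U ⊆ Icc 1 n) :
    Kop n (fSvec S) U = quadSum (S ∩ U).card (S \ U).card / 4 ^ S.card := by
  have hd : Disjoint U (Icc 1 n \ U) := disjoint_sdiff
  have hSc : S ∩ (Icc 1 n \ U) = S \ U := by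
    rw [← inter_sdiff_assoc, inter_eq_left.2 hS]
  have hcard : (S ∩ U).card + (S \ U).card = S.card := by
    rw [add_comm]; exact card_sdiff_add_card_inter S U
  have h1 : Kop n (fSvec S) U = ∑ a ∈ U.powerset, arcsineWeight (U \ a).card a.card *
      ∑ b ∈ (Icc 1 n \ U).powerset, arcsineWeight ((Icc 1 n \ U) \ b).card b.card *
        ((-1) ^ ((S ∩ a).card + (S ∩ b).card) *
          S.card.choose ((S ∩ a).card + (S ∩ b).card)) := by
    rw [Kop]
    conv_lhs => rw [show (Icc 1 n).powerset = (U ∪ (Icc 1 n \ U)).powerset by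
      rw [union_sdiff_of_subset hU]]
    rw [sum_powerset_union_of_disjoint hd]
    refine sum_congr rfl fun a ha => ?_
    rw [mul_sum]
    refine sum_congr rfl fun b hb => ?_
    have ha' := mem_powerset.1 ha
    have hb' := mem_powerset.1 hb
    have hab : Disjoint a b := hd.mono ha' hb'
    have e1 : (Icc 1 n \ U) \ (a ∪ b) = (Icc 1 n \ U) \ b := by
      ext x; have := @ha' x; simp only [mem_sdiff, mem_union]; tauto
    have e2 : (a ∪ b) \ U = b := by
      ext x; have := @ha' x; have := @hb' x; simp only [mem_sdiff, mem_union] at *; tauto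
    have e3 : U \ (a ∪ b) = U \ a := by
      ext x; have := @hb' x; simp only [mem_sdiff, mem_union] at *; tauto
    have e4 : U ∩ (a ∪ b) = a := by
      ext x; have := @ha' x; have := @hb' x
      simp only [mem_sdiff, mem_union, mem_inter] at *; tauto
    have e5 : (S ∩ (a ∪ b)).card = (S ∩ a).card + (S ∩ b).card := by
      rw [inter_union_distrib_left, card_union_of_disjoint
        (hab.mono inter_subset_right inter_subset_right)]
    rw [Kmat_eq_arcsineWeight_mul hU
      (union_subset (ha'.trans hU) (hb'.trans sdiff_subset)), e1, e2, e3, e4, fSvec, e5]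
    ring
  have h2 (a : Finset ℕ) := sum_powerset_arcsineWeight_mul (Icc 1 n \ U) S
    (fun j => (-1) ^ ((S ∩ a).card + j) * S.card.choose ((S ∩ a).card + j))
  simp only [hSc] at h2
  simp only [h1, h2]
  have h3 := sum_powerset_arcsineWeight_mul U S
    (fun i => (∑ w ∈ antidiagonal (S \ U).card, realCentralBinom w.1 * realCentralBinom w.2 *
      ((-1) ^ (i + w.1) * S.card.choose (i + w.1))) / 4 ^ (S \ U).card)
  rw [h3, quadSum, hcard]
  simp only [← mul_div_assoc]
  rw [← sum_div, div_div, ← pow_add, add_comm (S \ U).card, hcard]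

/-- For every S ⊆ {1,…,n}: if |S| = 2k then K_n f_S = β_k f_S with
β_k = C(2k,k)²/16^k; if |S| is odd then K_n f_S = 0. -/
theorem fS_eigenvector (n : ℕ) (S : Finset ℕ) (hS : S ⊆ Finset.Icc 1 n) :
    (∀ k, S.card = 2 * k →
      ∀ U ⊆ Finset.Icc 1 n, Kop n (fSvec S) U = betaEV k * fSvec S U) ∧
    (Odd S.card → ∀ U ⊆ Finset.Icc 1 n, Kop n (fSvec S) U = 0) := by
  have hcard (U : Finset ℕ) : (S ∩ U).card + (S \ U).card = S.card := by
    rw [add_comm]; exact card_sdiff_add_card_inter S U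
  refine ⟨fun k hk U hU => ?_, fun hodd U hU => ?_⟩
  · rw [Kop_fSvec_eq_quadSum hS hU, quadSum_eq, hcard, hk, quadSum_zero_even, betaEV, fSvec, hk,
      pow_mul, realCentralBinom]
    norm_num
    ring
  · obtain ⟨k, hk⟩ := hodd
    rw [Kop_fSvec_eq_quadSum hS hU, quadSum_eq, hcard, hk, quadSum_zero_odd]
    simp
end
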